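/- arXiv:1710.10922 — 3 statements merged into one kernel-verified Lean document; each statement's English description precedes it below -/
import Mathlib

section
/- Let q ≥ 2 be an integer, let c : (0,∞) → (0,∞), and let p > 2. There exists a constant C = C(q, p, c) > 0 such that the following holds. Let G be any finite (q+1)-regular simple graph with vertex set V and let N ≥ 1 be an integer such that Condition (★) holds with the function c and the integer N. Then every eigenfunction ψ of T_q (i.e. ψ ≠ 0 with T_q ψ = λψ for some real λ) satisfies ‖ψ‖_p ≤ C · ‖ψ‖_2 / √N. -/
open Finset

/-- The normalized adjacency operator `T_q f (x) = q^{-1/2} ∑_{y ~ x} f(y)`. -/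
noncomputable def Tq {V : Type*} [Fintype V] (q : ℕ) (G : SimpleGraph V)
    [DecidableRel G.Adj] (f : V → ℝ) : V → ℝ :=
  fun x => (Real.sqrt q)⁻¹ * ∑ y ∈ G.neighborFinset x, f y

/-- The sphere-averaging operators: `S_0 = Id`, `S_1 = T_q`,
`S_2 = T_q ∘ S_1 - (1 + 1/q)·Id`, `S_{n+1} = T_q ∘ S_n - S_{n-1}` for `n ≥ 2`. -/
noncomputable def Sop {V : Type*} [Fintype V] (q : ℕ) (G : SimpleGraph V)
    [DecidableRel G.Adj] : ℕ → (V → ℝ) → (V → ℝ)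
  | 0 => fun f => f
  | 1 => fun f => Tq q G f
  | 2 => fun f x => Tq q G (Tq q G f) x - (1 + 1 / (q : ℝ)) * f x
  | (n + 3) => fun f x => Tq q G (Sop q G (n + 2) f) x - Sop q G (n + 1) f x

/-- The kernel `K_n(x,y) = (S_n δ_y)(x)`. -/
noncomputable def Kker {V : Type*} [Fintype V] [DecidableEq V] (q : ℕ) (G : SimpleGraph V)
    [DecidableRel G.Adj] (n : ℕ) (x y : V) : ℝ :=
  Sop q G n (fun z => if z = y then 1 else 0) x

/-- Condition (★): for every `δ > 0` and every `1 ≤ n ≤ N`,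
`max_{x,y} |K_n(x,y)| ≤ c(δ) · q^{(-1/2+δ)n}`. -/
def CondStar {V : Type*} [Fintype V] [DecidableEq V] (q : ℕ) (G : SimpleGraph V)
    [DecidableRel G.Adj] (c : ℝ → ℝ) (N : ℕ) : Prop :=
  ∀ δ : ℝ, 0 < δ → ∀ n : ℕ, 1 ≤ n → n ≤ N → ∀ x y : V,
    |Kker q G n x y| ≤ c δ * (q : ℝ) ^ ((-1 / 2 + δ) * (n : ℝ))

/-- The `ℓ^p` norm with respect to counting measure: `(∑_x |f(x)|^p)^{1/p}`. -/
noncomputable def lpN {V : Type*} [Fintype V] (p : ℝ) (f : V → ℝ) : ℝ :=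
  (∑ x, |f x| ^ p) ^ (1 / p)

open Matrix Polynomial

section Operators

lemma sq_dotProduct_le {V : Type*} [Fintype V] (f g : V → ℝ) : (f ⬝ᵥ g) ^ 2 ≤ (f ⬝ᵥ f) * (g ⬝ᵥ g) := by
  simpa [dotProduct, sq] using Finset.sum_mul_sq_le_sq_mul_sq Finset.univ f g

variable {V : Type*} [Fintype V] (q : ℕ) (G : SimpleGraph V) [DecidableRel G.Adj]

/-- The matrix of `T_q / 2`. -/
noncomputable def halfTq : Matrix V V ℝ := (2 * Real.sqrt q)⁻¹ • G.adjMatrix ℝ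

lemma Tq_eq_mulVec (f : V → ℝ) : Tq q G f = (2 : ℝ) • (halfTq q G *ᵥ f) := by
  funext x
  simp only [Tq, halfTq, smul_mulVec, Pi.smul_apply, SimpleGraph.adjMatrix_mulVec_apply,
    smul_eq_mul, mul_inv]
  ring

variable [DecidableEq V]

/-- Application of `P(T_q / 2)` to a function. -/
noncomputable def polyOp (P : ℝ[X]) (f : V → ℝ) : V → ℝ := aeval (halfTq q G) P *ᵥ f

lemma polyOp_mul (P Q : ℝ[X]) (f : V → ℝ) :
    polyOp q G (P * Q) f = polyOp q G P (polyOp q G Q f) := by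
  simp [polyOp, mulVec_mulVec]

lemma polyOp_sub (P Q : ℝ[X]) (f : V → ℝ) :
    polyOp q G (P - Q) f = polyOp q G P f - polyOp q G Q f := by
  simp [polyOp, sub_mulVec]

lemma polyOp_C_mul (a : ℝ) (P : ℝ[X]) (f : V → ℝ) :
    polyOp q G (C a * P) f = a • polyOp q G P f := by
  simp [polyOp, ← smul_eq_C_mul, smul_mulVec]

lemma polyOp_two_mul_X_mul (P : ℝ[X]) (f : V → ℝ) :
    polyOp q G (2 * X * P) f = Tq q G (polyOp q G P f) := by
  rw [Tq_eq_mulVec, show (2 : ℝ[X]) * X * P = C 2 * (X * P) by rw [mul_assoc]; rfl,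
    polyOp_C_mul, polyOp_mul]
  simp [polyOp]

/-- The sphere-averaging operators in terms of Chebyshev polynomials of the second kind. -/
lemma Sop_succ_eq_polyOp (n : ℕ) (f : V → ℝ) :
    Sop q G (n + 1) f =
      polyOp q G (Chebyshev.U ℝ (n + 1) - C ((q : ℝ)⁻¹) * Chebyshev.U ℝ (n - 1)) f := by
  induction n using Nat.strong_induction_on with
  | _ n ih =>
    match n with
    | 0 =>
      have := polyOp_two_mul_X_mul q G 1 f
      simp [Sop, polyOp] at *
      exact this.symm
    | 1 =>
      have h : Chebyshev.U ℝ (((1 : ℕ) : ℤ) + 1) - C ((q : ℝ)⁻¹) * Chebyshev.U ℝ (((1 : ℕ) : ℤ) - 1)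
          = 2 * X * (2 * X * 1) - C (1 + (q : ℝ)⁻¹) * 1 := by
        norm_num [Chebyshev.U_two, -map_inv₀]
        ring
      rw [h, polyOp_sub, polyOp_two_mul_X_mul, polyOp_two_mul_X_mul, polyOp_C_mul]
      funext x
      simp [Sop, polyOp]
    | (n + 2) =>
      have h : Chebyshev.U ℝ (((n + 2 : ℕ) : ℤ) + 1)
            - C ((q : ℝ)⁻¹) * Chebyshev.U ℝ (((n + 2 : ℕ) : ℤ) - 1)
          = 2 * X * (Chebyshev.U ℝ (((n + 1 : ℕ) : ℤ) + 1)
              - C ((q : ℝ)⁻¹) * Chebyshev.U ℝ (((n + 1 : ℕ) : ℤ) - 1))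
            - (Chebyshev.U ℝ ((n : ℤ) + 1) - C ((q : ℝ)⁻¹) * Chebyshev.U ℝ ((n : ℤ) - 1)) := by
        have h1 := Chebyshev.U_add_two ℝ ((n : ℤ) + 1)
        have h2 := Chebyshev.U_add_two ℝ ((n : ℤ) - 1)
        push_cast
        ring_nf at h1 h2 ⊢
        rw [h1, h2]
        ring
      rw [h, polyOp_sub, polyOp_two_mul_X_mul, ← ih (n + 1) (by omega), ← ih n (by omega)]
      rfl

lemma Kker_succ_eq (n : ℕ) (x y : V) :
    Kker q G (n + 1) x y = aeval (halfTq q G) (Chebyshev.U ℝ (n + 1)) x y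
      - (q : ℝ)⁻¹ * aeval (halfTq q G) (Chebyshev.U ℝ (n - 1)) x y := by
  have h : (fun z : V => if z = y then (1 : ℝ) else 0) = Pi.single y 1 := by
    funext z; simp [Pi.single_apply]
  rw [Kker, Sop_succ_eq_polyOp, h, polyOp, mulVec_single_one]
  simp [← smul_eq_C_mul, -map_inv₀]

lemma isSymm_aeval_halfTq (P : ℝ[X]) : (aeval (halfTq q G) P).IsSymm := by
  have h : (halfTq q G).IsSymm := (G.isSymm_adjMatrix).smul _
  induction P using Polynomial.induction_on' with
  | add P Q hP hQ => rw [map_add]; exact hP.add hQ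
  | monomial n a =>
    rw [aeval_monomial, ← Algebra.smul_def]
    exact (h.pow n).smul a

lemma dotProduct_polyOp (P : ℝ[X]) (f g : V → ℝ) :
    f ⬝ᵥ polyOp q G P g = polyOp q G P f ⬝ᵥ g := by
  rw [polyOp, polyOp, dotProduct_mulVec, ← mulVec_transpose, (isSymm_aeval_halfTq q G P).eq]

lemma polyOp_eigenfunction {ψ : V → ℝ} {lam : ℝ} (hψ : Tq q G ψ = fun x => lam * ψ x)
    (P : ℝ[X]) : polyOp q G P ψ = P.eval (lam / 2) • ψ := by
  have h : halfTq q G *ᵥ ψ = (lam / 2) • ψ := by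
    rw [Tq_eq_mulVec] at hψ
    funext x
    have := congrFun hψ x
    simp only [Pi.smul_apply, smul_eq_mul] at this ⊢
    linarith
  induction P using Polynomial.induction_on with
  | C a => simp [polyOp, Algebra.algebraMap_eq_smul_one, smul_mulVec]
  | add P Q hP hQ => simp only [polyOp, map_add, add_mulVec, eval_add, add_smul] at *; rw [hP, hQ]
  | monomial n a ih =>
    rw [pow_succ, ← mul_assoc, polyOp_mul]
    simp only [polyOp, aeval_X, h, mulVec_smul] at ih ⊢
    rw [ih, smul_smul]
    simp only [eval_mul, eval_X, mul_comm]

/-- The quadratic form `⟨f, P(T_q / 2) f⟩`, as a linear functional of `P`. -/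
noncomputable def polyForm (f : V → ℝ) : ℝ[X] →ₗ[ℝ] ℝ where
  toFun P := f ⬝ᵥ polyOp q G P f
  map_add' P Q := by simp [polyOp, add_mulVec]
  map_smul' a P := by simp [polyOp, smul_mulVec]

lemma polyForm_one (f : V → ℝ) : polyForm q G f 1 = f ⬝ᵥ f := by
  simp [polyForm, polyOp]

lemma polyForm_mul (f : V → ℝ) (P Q : ℝ[X]) :
    polyForm q G f (P * Q) = polyOp q G P f ⬝ᵥ polyOp q G Q f := by
  change f ⬝ᵥ polyOp q G (P * Q) f = _
  rw [polyOp_mul, dotProduct_polyOp]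

lemma sq_polyForm_le (f : V → ℝ) (P : ℝ[X]) :
    polyForm q G f P ^ 2 ≤ (f ⬝ᵥ f) * polyForm q G f (P * P) := by
  rw [polyForm_mul]
  exact sq_dotProduct_le _ _

lemma sq_eval_mul_dotProduct_le {ψ : V → ℝ} {lam : ℝ} (hψ : Tq q G ψ = fun x => lam * ψ x)
    (P : ℝ[X]) (f : V → ℝ) :
    (P.eval (lam / 2) * (ψ ⬝ᵥ f)) ^ 2 ≤ (ψ ⬝ᵥ ψ) * polyForm q G f (P * P) := by
  have h : P.eval (lam / 2) * (ψ ⬝ᵥ f) = ψ ⬝ᵥ polyOp q G P f := by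
    rw [dotProduct_polyOp, polyOp_eigenfunction q G hψ, smul_dotProduct, smul_eq_mul]
  rw [h, polyForm_mul]
  exact sq_dotProduct_le _ _

lemma polyForm_T_mul_T (f : V → ℝ) (m k : ℤ) :
    polyForm q G f (Chebyshev.T ℝ m * Chebyshev.T ℝ k) =
      (polyForm q G f (Chebyshev.T ℝ (m + k)) + polyForm q G f (Chebyshev.T ℝ (m - k))) / 2 := by
  rw [← map_add, ← Chebyshev.T_mul_T, mul_assoc,
    show (2 : ℝ[X]) * (Chebyshev.T ℝ m * Chebyshev.T ℝ k)
      = (2 : ℝ) • (Chebyshev.T ℝ m * Chebyshev.T ℝ k) by rw [ofNat_smul_eq_nsmul, nsmul_eq_mul]; rfl,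
    map_smul]
  simp

lemma abs_polyForm_le {B : ℝ} {f : V → ℝ} {P : ℝ[X]}
    (hB : ∀ x y, |aeval (halfTq q G) P x y| ≤ B) :
    |polyForm q G f P| ≤ B * (∑ x, |f x|) ^ 2 := by
  change |∑ x, f x * ∑ y, aeval (halfTq q G) P x y * f y| ≤ _
  simp only [Finset.mul_sum]
  calc _ ≤ ∑ x, ∑ y, |f x * (aeval (halfTq q G) P x y * f y)| :=
        (Finset.abs_sum_le_sum_abs _ _).trans
          (Finset.sum_le_sum fun x _ => Finset.abs_sum_le_sum_abs _ _)
    _ ≤ ∑ x, ∑ y, B * (|f x| * |f y|) := by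
        refine Finset.sum_le_sum fun x _ => Finset.sum_le_sum fun y _ => ?_
        rw [abs_mul, abs_mul, mul_left_comm]
        gcongr
        exact hB x y
    _ = _ := by
        rw [sq, Finset.sum_mul_sum, Finset.mul_sum]
        simp only [Finset.mul_sum]

end Operators

section RealLemmas

lemma pow_two_pow_le_max {u : ℕ → ℝ} (h0 : ∀ n, 0 ≤ u n)
    (h : ∀ n, u n ^ 2 ≤ (u (2 * n) + 1) / 2) (n j : ℕ) :
    u n ^ (2 ^ j) ≤ max 1 (u (2 ^ j * n)) := by
  induction j with
  | zero => simp
  | succ j ih =>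
    have h1 : u n ^ (2 ^ (j + 1)) = (u n ^ (2 ^ j)) ^ 2 := by rw [pow_succ 2, pow_mul]
    have h2 : (u n ^ (2 ^ j)) ^ 2 ≤ (max 1 (u (2 ^ j * n))) ^ 2 :=
      pow_le_pow_left₀ (pow_nonneg (h0 n) _) ih 2
    have h3 := h (2 ^ j * n)
    rw [← mul_assoc, ← pow_succ'] at h3
    rw [h1]
    refine h2.trans ?_
    rcases le_total 1 (u (2 ^ j * n)) with h4 | h4
    · rw [max_eq_right h4]
      refine h3.trans ?_
      rcases le_total 1 (u (2 ^ (j + 1) * n)) with h5 | h5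
      · rw [max_eq_right h5]; linarith
      · rw [max_eq_left h5]; linarith
    · rw [max_eq_left h4]; simp

/-- Summing an antitone function of the ranks of the elements of a finite set. -/
lemma sum_rank_le {ι : Type*} (s : Finset ι) (g : ι → ℝ) (φ : ℕ → ℝ)
    (hφ : ∀ a b, 1 ≤ a → a ≤ b → φ b ≤ φ a) :
    ∑ x ∈ s, φ #{y ∈ s | g x ≤ g y} ≤ ∑ k ∈ Finset.range #s, φ (k + 1) := by
  classical
  induction s using Finset.induction_on_min_value g with
  | empty => simp
  | insert a s ha hmin ih =>
    rw [Finset.sum_insert ha, Finset.card_insert_of_notMem ha, Finset.sum_range_succ, add_comm]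
    have h1 : #{y ∈ insert a s | g a ≤ g y} = #s + 1 := by
      rw [Finset.filter_true_of_mem, Finset.card_insert_of_notMem ha]
      simpa using hmin
    rw [h1]
    refine add_le_add_left ((Finset.sum_le_sum fun x hx => ?_).trans ih) _
    refine hφ _ _ (Finset.card_pos.2 ⟨x, by simp [hx]⟩) (Finset.card_le_card ?_)
    exact Finset.filter_subset_filter _ (Finset.subset_insert _ _)

lemma geom_sum_le_inv {R : ℝ} (h0 : 0 ≤ R) (h1 : R < 1) (L : ℕ) :
    ∑ k ∈ Finset.range L, R ^ k ≤ (1 - R)⁻¹ := by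
  rw [← tsum_geometric_of_lt_one h0 h1]
  exact (summable_geometric_of_lt_one h0 h1).sum_le_tsum _ fun _ _ => pow_nonneg h0 _

lemma sum_pow_natAbs_sub_le {R : ℝ} (h0 : 0 ≤ R) (h1 : R < 1) (L i : ℕ) :
    ∑ j ∈ Finset.range L, R ^ ((i : ℤ) - j).natAbs ≤ 2 * (1 - R)⁻¹ := by
  calc _ ≤ ∑ j ∈ Finset.range (i + 1 + L), R ^ ((i : ℤ) - j).natAbs :=
        Finset.sum_le_sum_of_subset_of_nonneg (Finset.range_mono (by omega))
          fun _ _ _ => pow_nonneg h0 _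
    _ = ∑ j ∈ Finset.range (i + 1), R ^ j + ∑ j ∈ Finset.range L, R ^ (j + 1) := by
        rw [Finset.sum_range_add, ← Finset.sum_range_reflect (fun j => R ^ j)]
        congr 1
        · refine Finset.sum_congr rfl fun j hj => ?_
          rw [Finset.mem_range] at hj
          congr 1; omega
        · refine Finset.sum_congr rfl fun j hj => ?_
          congr 1; omega
    _ ≤ (1 - R)⁻¹ + (1 - R)⁻¹ := by
        refine add_le_add (geom_sum_le_inv h0 h1 _)
          ((Finset.sum_le_sum fun j _ => ?_).trans (geom_sum_le_inv h0 h1 L))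
        exact pow_le_pow_of_le_one h0 h1.le (Nat.le_succ j)
    _ = _ := by ring

lemma le_sum_abs_eval_T (M : ℕ) (x : ℝ) :
    (M : ℝ) / 4 ≤ ∑ i ∈ Finset.range (2 * M), |(Chebyshev.T ℝ ((i + 1 : ℕ) : ℤ)).eval x| := by
  set a : ℕ → ℝ := fun n => |(Chebyshev.T ℝ (n : ℤ)).eval x| with ha
  have h0 : ∀ n, 0 ≤ a n := fun n => abs_nonneg _
  have h1 : ∀ n, 1 / 2 ≤ a n + a (2 * n) := by
    intro n
    have h := congrArg (Polynomial.eval x) (Chebyshev.T_mul_T ℝ (n : ℤ) n)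
    rw [← two_mul, sub_self] at h
    simp only [eval_mul, eval_add, Chebyshev.T_zero, eval_one, eval_ofNat] at h
    simp only [ha, Nat.cast_mul, Nat.cast_ofNat]
    set t := (Chebyshev.T ℝ (n : ℤ)).eval x
    by_contra! hlt
    have h2 := neg_abs_le ((Chebyshev.T ℝ (2 * (n : ℤ))).eval x)
    have h3 := abs_nonneg t
    have h4 := sq_abs t
    nlinarith [abs_nonneg ((Chebyshev.T ℝ (2 * (n : ℤ))).eval x)]
  have h2 : ∑ i ∈ Finset.range M, a (2 * (i + 1)) ≤ ∑ i ∈ Finset.range (2 * M), a (i + 1) := by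
    clear_value a
    induction M with
    | zero => simp
    | succ M ih =>
      rw [Finset.sum_range_succ, show 2 * (M + 1) = 2 * M + 1 + 1 by ring, Finset.sum_range_succ,
        Finset.sum_range_succ]
      have := h0 (2 * M + 1)
      linarith
  have h3 : ∑ i ∈ Finset.range M, a (i + 1) ≤ ∑ i ∈ Finset.range (2 * M), a (i + 1) :=
    Finset.sum_le_sum_of_subset_of_nonneg (Finset.range_mono (by omega)) fun _ _ _ => h0 _
  have h4 : ∑ i ∈ Finset.range M, (1 / 2 : ℝ) ≤ ∑ i ∈ Finset.range M, (a (i + 1) + a (2 * (i + 1))) :=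
    Finset.sum_le_sum fun i _ => h1 _
  rw [Finset.sum_add_distrib] at h4
  simp only [Finset.sum_const, Finset.card_range, nsmul_eq_mul] at h4
  change (M : ℝ) / 4 ≤ ∑ i ∈ Finset.range (2 * M), a (i + 1)
  linarith

end RealLemmas

section Decay

variable {V : Type*} [Fintype V] [DecidableEq V] {q : ℕ} {G : SimpleGraph V} [DecidableRel G.Adj]

lemma abs_aeval_U_le {Q c : ℝ} (hQ0 : 0 < Q) (hQ : Q ^ 4 = (q : ℝ)⁻¹) (hQ2 : Q ^ 2 ≤ 3 / 4)
    (hc : 1 ≤ c) {N : ℕ} {x y : V}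
    (hK : ∀ n, 1 ≤ n → n ≤ N → |Kker q G n x y| ≤ c * Q ^ n) (n : ℕ) (hn : n ≤ N) :
    |aeval (halfTq q G) (Chebyshev.U ℝ (n : ℤ)) x y| ≤ 4 * c * Q ^ n := by
  induction n using Nat.strong_induction_on with
  | _ n ih =>
    match n with
    | 0 =>
      simp only [Nat.cast_zero, Chebyshev.U_zero, map_one, pow_zero, mul_one, one_apply]
      split_ifs <;> norm_num <;> linarith
    | 1 =>
      have h := Kker_succ_eq q G 0 x y
      have h' := hK 1 le_rfl hn
      simp only [Nat.cast_zero, zero_add, zero_sub, Chebyshev.U_neg_one, map_zero,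
        Matrix.zero_apply, mul_zero, sub_zero] at h
      rw [h] at h'
      rw [Nat.cast_one]
      refine h'.trans ?_
      have : 0 ≤ c * Q ^ 1 := by positivity
      linarith
    | (n + 2) =>
      have h := Kker_succ_eq q G (n + 1) x y
      have h' := hK (n + 2) (by omega) hn
      rw [h] at h'
      have h'' := ih n (by omega) (by omega)
      rw [show ((n + 1 : ℕ) : ℤ) - 1 = n by push_cast; ring,
        show ((n + 1 : ℕ) : ℤ) + 1 = (n + 2 : ℕ) by push_cast; ring, ← hQ] at h'
      set A := aeval (halfTq q G) (Chebyshev.U ℝ ((n + 2 : ℕ) : ℤ)) x y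
      set B := aeval (halfTq q G) (Chebyshev.U ℝ (n : ℤ)) x y
      have h1 : |A| ≤ |A - Q ^ 4 * B| + Q ^ 4 * |B| := by
        have := abs_add_le (A - Q ^ 4 * B) (Q ^ 4 * B)
        rwa [sub_add_cancel, abs_mul (Q ^ 4), abs_of_pos (by positivity : (0 : ℝ) < Q ^ 4)] at this
      calc |A| ≤ c * Q ^ (n + 2) + Q ^ 4 * (4 * c * Q ^ n) := by
            refine h1.trans (add_le_add h' ?_)
            gcongr
        _ = c * Q ^ (n + 2) * (1 + 4 * Q ^ 2) := by ring
        _ ≤ c * Q ^ (n + 2) * 4 := by gcongr; linarith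
        _ = _ := by ring

lemma abs_aeval_T_le {Q c : ℝ} (hQ0 : 0 < Q) (hQ : Q ^ 4 = (q : ℝ)⁻¹) (hQ2 : Q ^ 2 ≤ 3 / 4)
    (hc : 1 ≤ c) {N : ℕ} {x y : V}
    (hK : ∀ n, 1 ≤ n → n ≤ N → |Kker q G n x y| ≤ c * Q ^ n) (n : ℕ) (hn1 : 1 ≤ n) (hn : n ≤ N) :
    |aeval (halfTq q G) (Chebyshev.T ℝ (n : ℤ)) x y| ≤ 4 * c / Q ^ 2 * Q ^ n := by
  have hU := abs_aeval_U_le hQ0 hQ hQ2 hc hK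
  match n with
  | 1 =>
    have h := hU 1 hn
    simp only [Nat.cast_one, Chebyshev.U_one, Chebyshev.T_one, aeval_X, map_mul] at h ⊢
    have e : (aeval (halfTq q G)) (2 : ℝ[X]) * halfTq q G = (2 : ℝ) • halfTq q G := by
      rw [map_ofNat, ofNat_smul_eq_nsmul, nsmul_eq_mul]; rfl
    rw [e, Matrix.smul_apply, smul_eq_mul, abs_mul, abs_two] at h
    have h2 : 4 * c * Q ^ 1 ≤ 4 * c / Q ^ 2 * Q ^ 1 := by
      gcongr
      rw [le_div_iff₀ (by positivity)]
      nlinarith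
    linarith [abs_nonneg (halfTq q G x y)]
  | (n + 2) =>
    have h := congrArg (fun P => aeval (halfTq q G) P x y) (Chebyshev.two_mul_T_eq_U_sub_U ℝ (n : ℤ))
    have e : (aeval (halfTq q G)) (2 * Chebyshev.T ℝ ((n : ℤ) + 2))
        = (2 : ℝ) • (aeval (halfTq q G)) (Chebyshev.T ℝ ((n : ℤ) + 2)) := by
      rw [map_mul, map_ofNat, ofNat_smul_eq_nsmul, nsmul_eq_mul]; rfl
    simp only [e, map_sub, Matrix.sub_apply, Matrix.smul_apply, smul_eq_mul] at h
    have h1 := hU (n + 2) hn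
    have h2 := hU n (by omega)
    push_cast at h1 ⊢
    have h3 := abs_sub (aeval (halfTq q G) (Chebyshev.U ℝ ((n : ℤ) + 2)) x y)
      (aeval (halfTq q G) (Chebyshev.U ℝ (n : ℤ)) x y)
    rw [← h, abs_mul, abs_two] at h3
    have h4 : 4 * c * Q ^ (n + 2) ≤ 4 * c * Q ^ n := by
      gcongr 4 * c * ?_
      rw [pow_add]
      have : 0 < Q ^ n := by positivity
      nlinarith
    have h5 : 4 * c / Q ^ 2 * Q ^ (n + 2) = 4 * c * Q ^ n := by
      rw [pow_add]
      field_simp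
    rw [h5]
    linarith

lemma abs_polyForm_T_le {Q K E : ℝ} (hQ0 : 0 < Q) (hQ1 : Q < 1) (hK : 1 ≤ K) {N : ℕ}
    (hker : ∀ n : ℕ, 1 ≤ n → n ≤ N → ∀ x y : V,
      |aeval (halfTq q G) (Chebyshev.T ℝ (n : ℤ)) x y| ≤ K * Q ^ n)
    {f : V → ℝ} (hE : 1 ≤ E) (hf2 : f ⬝ᵥ f = E) (hf1 : ∑ x, |f x| = E) (j n : ℕ)
    (hn : 2 ^ j * n ≤ N) :
    |polyForm q G f (Chebyshev.T ℝ (n : ℤ))| ≤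
      E * (K * E) ^ (((2 ^ j : ℕ) : ℝ)⁻¹) * (Q ^ (((2 ^ j : ℕ) : ℝ)⁻¹)) ^ n := by
  have hE0 : 0 < E := by linarith
  set u : ℕ → ℝ := fun n => |polyForm q G f (Chebyshev.T ℝ (n : ℤ))| / E with hu
  have hu0 : ∀ n, 0 ≤ u n := fun n => div_nonneg (abs_nonneg _) hE0.le
  have hu2 : ∀ n, u n ^ 2 ≤ (u (2 * n) + 1) / 2 := by
    intro n
    have h := sq_polyForm_le q G f (Chebyshev.T ℝ (n : ℤ))
    rw [polyForm_T_mul_T, sub_self, Chebyshev.T_zero, polyForm_one, hf2, ← two_mul] at h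
    simp only [hu, div_pow, sq_abs, Nat.cast_mul, Nat.cast_ofNat]
    rw [div_le_iff₀ (by positivity)]
    have h2 := le_abs_self (polyForm q G f (Chebyshev.T ℝ (2 * (n : ℤ))))
    refine h.trans ?_
    field_simp
    gcongr
  have huK : ∀ n, 1 ≤ n → n ≤ N → u n ≤ K * E * Q ^ n := by
    intro n h1 h2
    have h := abs_polyForm_le q G (f := f) (hker n h1 h2)
    rw [hf1] at h
    simp only [hu]
    rw [div_le_iff₀ hE0]
    exact h.trans (le_of_eq (by ring))
  have hKE : 1 ≤ K * E := by nlinarith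
  have key : u n ^ (2 ^ j) ≤ K * E * Q ^ n := by
    rcases Nat.eq_zero_or_pos n with rfl | hpos
    · have : u 0 = 1 := by
        simp only [hu, Nat.cast_zero, Chebyshev.T_zero, polyForm_one, hf2, abs_of_pos hE0]
        exact div_self hE0.ne'
      rw [this]; simpa using hKE
    · have hk : 1 ≤ 2 ^ j := Nat.one_le_two_pow
      have hle : n ≤ 2 ^ j * n := Nat.le_mul_of_pos_left n hk
      rcases le_total (u n) 1 with h | h
      · refine le_trans ?_ (huK n hpos (hle.trans hn))
        exact pow_le_of_le_one (hu0 n) h (by omega)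
      · rcases le_max_iff.1 (pow_two_pow_le_max hu0 hu2 n j) with h' | h'
        · have h1 : u n ≤ u n ^ (2 ^ j) := le_self_pow₀ h (by omega)
          have h2 := huK n hpos (hle.trans hn)
          linarith
        · refine (h'.trans (huK _ (hpos.trans_le hle) hn)).trans ?_
          gcongr ?_ * ?_
          exact pow_le_pow_of_le_one hQ0.le hQ1.le hle
  have h1 : u n ≤ (K * E * Q ^ n) ^ (((2 ^ j : ℕ) : ℝ)⁻¹) := by
    rw [← Real.pow_rpow_inv_natCast (hu0 n) (n := 2 ^ j) (by positivity)]
    exact Real.rpow_le_rpow (pow_nonneg (hu0 n) _) key (by positivity)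
  rw [Real.mul_rpow (by positivity) (by positivity), ← Real.rpow_pow_comm hQ0.le] at h1
  simp only [hu] at h1
  rw [div_le_iff₀ hE0] at h1
  linarith

lemma polyForm_sq_sum_le {R D : ℝ} (hR0 : 0 ≤ R) (hR1 : R < 1) (hD0 : 0 ≤ D) {f : V → ℝ} {L : ℕ}
    (hD : ∀ n : ℕ, n ≤ 2 * L → |polyForm q G f (Chebyshev.T ℝ (n : ℤ))| ≤ D * R ^ n)
    {ε : ℕ → ℝ} (hε : ∀ i, |ε i| ≤ 1) :
    polyForm q G f ((∑ i ∈ Finset.range L, ε i • Chebyshev.T ℝ ((i + 1 : ℕ) : ℤ)) *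
        ∑ i ∈ Finset.range L, ε i • Chebyshev.T ℝ ((i + 1 : ℕ) : ℤ)) ≤
      D * (L * (2 * (1 - R)⁻¹)) := by
  rw [Finset.sum_mul_sum]
  simp only [map_sum, smul_mul_smul_comm, map_smul, smul_eq_mul]
  calc _ ≤ ∑ i ∈ Finset.range L, ∑ j ∈ Finset.range L, D * R ^ ((i : ℤ) - j).natAbs := by
        refine Finset.sum_le_sum fun i hi => Finset.sum_le_sum fun j hj => ?_
        rw [Finset.mem_range] at hi hj
        refine (le_abs_self _).trans ?_
        rw [abs_mul, abs_mul]
        have h1 : |ε i| * |ε j| ≤ 1 := mul_le_one₀ (hε i) (abs_nonneg _) (hε j)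
        refine (mul_le_of_le_one_left (abs_nonneg _) h1).trans ?_
        rw [polyForm_T_mul_T]
        have h2 := hD (i + 1 + (j + 1)) (by omega)
        have h3 := hD ((i : ℤ) - j).natAbs (by omega)
        rw [Chebyshev.T_natAbs] at h3
        rw [show ((i + 1 : ℕ) : ℤ) + ((j + 1 : ℕ) : ℤ) = ((i + 1 + (j + 1) : ℕ) : ℤ) by push_cast; rfl,
          show ((i + 1 : ℕ) : ℤ) - ((j + 1 : ℕ) : ℤ) = (i : ℤ) - j by push_cast; ring]
        have h4 : D * R ^ (i + 1 + (j + 1)) ≤ D * R ^ ((i : ℤ) - j).natAbs := by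
          gcongr D * ?_
          exact pow_le_pow_of_le_one hR0 hR1.le (by omega)
        rw [abs_div, abs_two]
        have h5 := abs_add_le (polyForm q G f (Chebyshev.T ℝ ((i + 1 + (j + 1) : ℕ) : ℤ)))
          (polyForm q G f (Chebyshev.T ℝ ((i : ℤ) - j)))
        linarith
    _ = D * ∑ i ∈ Finset.range L, ∑ j ∈ Finset.range L, R ^ ((i : ℤ) - j).natAbs := by
        simp only [Finset.mul_sum]
    _ ≤ D * ∑ i ∈ Finset.range L, 2 * (1 - R)⁻¹ := by
        gcongr with i hi
        exact sum_pow_natAbs_sub_le hR0 hR1 L i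
    _ = _ := by simp

end Decay

section WeakType

variable {V : Type*} [Fintype V] [DecidableEq V] {q : ℕ} {G : SimpleGraph V} [DecidableRel G.Adj]

/-- Restricted weak-type estimate for an eigenfunction on a set where it is large. -/
lemma sq_mul_sq_card_le {Q K : ℝ} (hQ0 : 0 < Q) (hQ1 : Q < 1) (hK : 1 ≤ K) {N : ℕ}
    (hker : ∀ n : ℕ, 1 ≤ n → n ≤ N → ∀ x y : V,
      |aeval (halfTq q G) (Chebyshev.T ℝ (n : ℤ)) x y| ≤ K * Q ^ n)
    {ψ : V → ℝ} {lam : ℝ} (hψ : Tq q G ψ = fun x => lam * ψ x)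
    {S : Finset V} (hS : S.Nonempty) {a : ℝ} (ha : 0 ≤ a) (haS : ∀ x ∈ S, a ≤ |ψ x|)
    {j M : ℕ} (hM : 2 ^ j * (4 * M) ≤ N) :
    (M / 4 * (a * #S)) ^ 2 ≤ (ψ ⬝ᵥ ψ) * (#S * (K * #S) ^ (((2 ^ j : ℕ) : ℝ)⁻¹) *
      ((2 * M : ℕ) * (2 * (1 - Q ^ (((2 ^ j : ℕ) : ℝ)⁻¹))⁻¹))) := by
  set σ : ℝ := ((2 ^ j : ℕ) : ℝ)⁻¹ with hσ
  have hσ0 : 0 < σ := by positivity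
  have hE : (1 : ℝ) ≤ #S := by exact_mod_cast hS.card_pos
  set sgn : ℝ → ℝ := fun t => if 0 ≤ t then 1 else -1 with hsgn
  have sgn_mul : ∀ t, sgn t * t = |t| := by
    intro t
    simp only [hsgn]
    split_ifs with h
    · rw [abs_of_nonneg h, one_mul]
    · rw [abs_of_neg (not_le.1 h)]; ring
  have abs_sgn : ∀ t, |sgn t| = 1 := by
    intro t; simp only [hsgn]; split_ifs <;> simp
  set f : V → ℝ := fun x => if x ∈ S then sgn (ψ x) else 0 with hf
  have hf1 : ∑ x, |f x| = #S := by
    simp only [hf, apply_ite abs, abs_sgn, abs_zero]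
    simp
  have hf2 : f ⬝ᵥ f = #S := by
    have : ∀ x, f x * f x = if x ∈ S then 1 else 0 := by
      intro x
      simp only [hf]
      split_ifs
      · rw [← abs_mul_abs_self, abs_sgn, one_mul]
      · simp
    simp [dotProduct, this]
  have hψf : a * #S ≤ ψ ⬝ᵥ f := by
    have : ψ ⬝ᵥ f = ∑ x ∈ S, |ψ x| := by
      simp [dotProduct, hf, ← sgn_mul, mul_comm]
    rw [this, mul_comm, ← nsmul_eq_mul]
    exact Finset.card_nsmul_le_sum _ _ _ haS
  set P : ℝ[X] := ∑ i ∈ Finset.range (2 * M),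
    sgn ((Chebyshev.T ℝ ((i + 1 : ℕ) : ℤ)).eval (lam / 2)) • Chebyshev.T ℝ ((i + 1 : ℕ) : ℤ) with hP
  have hPe : (M : ℝ) / 4 ≤ P.eval (lam / 2) := by
    simp only [hP, eval_finsetSum, eval_smul, smul_eq_mul, sgn_mul]
    exact le_sum_abs_eval_T M _
  have h1 := sq_eval_mul_dotProduct_le q G hψ P f
  have h2 : polyForm q G f (P * P) ≤ _ :=
    polyForm_sq_sum_le (q := q) (G := G) (R := Q ^ σ) (D := #S * (K * #S) ^ σ) (by positivity)
      (Real.rpow_lt_one hQ0.le hQ1 hσ0) (by positivity) (f := f) (L := 2 * M)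
      (fun n hn => abs_polyForm_T_le hQ0 hQ1 hK hker hE hf2 hf1 j n
        ((Nat.mul_le_mul_left _ (by omega)).trans hM)) (fun i => (abs_sgn _).le)
  have h0 : 0 ≤ ψ ⬝ᵥ ψ := Finset.sum_nonneg fun x _ => mul_self_nonneg _
  refine le_trans ?_ (h1.trans (mul_le_mul_of_nonneg_left h2 h0))
  have hP0 : 0 ≤ P.eval (lam / 2) := le_trans (by positivity) hPe
  gcongr

/-- Weak-type estimate: the value of an eigenfunction in terms of the size of a superlevel set. -/
lemma sq_le_of_superlevel {Q K : ℝ} (hQ0 : 0 < Q) (hQ1 : Q < 1) (hK : 1 ≤ K) {N : ℕ} (hN : 1 ≤ N)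
    (hker : ∀ n : ℕ, 1 ≤ n → n ≤ N → ∀ x y : V,
      |aeval (halfTq q G) (Chebyshev.T ℝ (n : ℤ)) x y| ≤ K * Q ^ n)
    {ψ : V → ℝ} {lam : ℝ} (hψ : Tq q G ψ = fun x => lam * ψ x)
    {S : Finset V} (hS : S.Nonempty) {a : ℝ} (ha : 0 ≤ a) (haS : ∀ x ∈ S, a ≤ |ψ x|) (j : ℕ) :
    a ^ 2 ≤ 512 * 2 ^ j * K ^ (((2 ^ j : ℕ) : ℝ)⁻¹) * (1 - Q ^ (((2 ^ j : ℕ) : ℝ)⁻¹))⁻¹ *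
      (ψ ⬝ᵥ ψ) / N * (#S : ℝ) ^ ((((2 ^ j : ℕ) : ℝ)⁻¹) - 1) := by
  have hE : (1 : ℝ) ≤ #S := by exact_mod_cast hS.card_pos
  have h0 : 0 ≤ ψ ⬝ᵥ ψ := Finset.sum_nonneg fun x _ => mul_self_nonneg _
  obtain ⟨M, hM1, hM2⟩ : ∃ M : ℕ, 2 ^ j * (4 * M) ≤ N ∧ N < 2 ^ j * (4 * (M + 1)) := by
    have hk : 0 < 4 * 2 ^ j := by positivity
    refine ⟨N / (4 * 2 ^ j), ?_, ?_⟩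
    · have := Nat.div_mul_le_self N (4 * 2 ^ j); linarith
    · have := Nat.lt_div_mul_add (a := N) hk; linarith
  have h1 := sq_mul_sq_card_le hQ0 hQ1 hK hker hψ hS ha haS hM1
  set σ : ℝ := ((2 ^ j : ℕ) : ℝ)⁻¹ with hσ
  have hσ0 : 0 < σ := by positivity
  have hN0 : (0 : ℝ) < N := by exact_mod_cast hN
  have hKσ : 1 ≤ K ^ σ := Real.one_le_rpow hK hσ0.le
  have hR0 : 0 < Q ^ σ := by positivity
  have hR : 0 < 1 - Q ^ σ := sub_pos.2 (Real.rpow_lt_one hQ0.le hQ1 hσ0)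
  have hRinv : 1 ≤ (1 - Q ^ σ)⁻¹ := one_le_inv_iff₀.2 ⟨hR, by linarith⟩
  have hE0 : (0 : ℝ) < #S := by linarith
  have hM2' : (N : ℝ) ≤ 2 ^ j * (4 * (M + 1)) := by exact_mod_cast hM2.le
  have hEσ : (#S : ℝ) ^ (σ - 1) = (#S : ℝ) ^ σ / #S := by
    rw [Real.rpow_sub hE0, Real.rpow_one]
  have hEσ1 : 1 ≤ (#S : ℝ) ^ σ := Real.one_le_rpow hE hσ0.le
  set e : ℝ := (#S : ℝ)
  set Y := K ^ σ
  set Z := (1 - Q ^ σ)⁻¹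
  set W := ψ ⬝ᵥ ψ with hW
  set k : ℝ := 2 ^ j
  have hk0 : 0 < k := by positivity
  rw [hEσ]
  rcases Nat.eq_zero_or_pos M with rfl | hMpos
  · have h2 : a ^ 2 * e ≤ W := by
      calc a ^ 2 * e = ∑ x ∈ S, a ^ 2 := by rw [Finset.sum_const, nsmul_eq_mul, mul_comm]
        _ ≤ ∑ x ∈ S, ψ x * ψ x := Finset.sum_le_sum fun x hx => by
            rw [← abs_mul_abs_self, ← sq]
            exact pow_le_pow_left₀ ha (haS x hx) 2
        _ ≤ W := Finset.sum_le_sum_of_subset_of_nonneg (Finset.subset_univ S)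
            fun x _ _ => mul_self_nonneg _
    have h3 : a ^ 2 ≤ W / e := by rwa [le_div_iff₀ hE0]
    have h4 : 1 ≤ 512 * k / N := by
      rw [le_div_iff₀ hN0]
      norm_num at hM2'
      nlinarith
    calc a ^ 2 ≤ W / e := h3
      _ = 1 * 1 * 1 * 1 * (W / e) := by ring
      _ ≤ (512 * k / N) * Y * Z * e ^ σ * (W / e) := by gcongr
      _ = _ := by ring
  · have hM0 : (1 : ℝ) ≤ M := by exact_mod_cast hMpos
    rw [Real.mul_rpow (by linarith) hE0.le] at h1
    push_cast at h1
    have h2 : a ^ 2 ≤ 64 * Y * Z * W * e ^ σ / e / M := by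
      rw [le_div_iff₀ (by linarith), le_div_iff₀ hE0]
      refine le_of_mul_le_mul_left ?_ (by positivity : (0 : ℝ) < M * e / 16)
      calc (M : ℝ) * e / 16 * (a ^ 2 * M * e) = (M / 4 * (a * e)) ^ 2 := by ring
        _ ≤ _ := h1
        _ = _ := by ring
    have h3 : (M : ℝ)⁻¹ ≤ 8 * k / N := by
      rw [inv_le_iff_one_le_mul₀ (by linarith), div_mul_eq_mul_div, le_div_iff₀ hN0]
      nlinarith
    calc a ^ 2 ≤ 64 * Y * Z * W * e ^ σ / e * (M : ℝ)⁻¹ := h2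
      _ ≤ 64 * Y * Z * W * e ^ σ / e * (8 * k / N) := by gcongr
      _ = _ := by ring

end WeakType

/-- Passage from a weak-type estimate to a bound for the `ℓ^p` norm. -/
lemma lpN_le_of_superlevel {V : Type*} [Fintype V] {p s A : ℝ} (hp : 0 < p) (hs : 1 < s * (p / 2))
    (hA : 0 ≤ A) {ψ : V → ℝ}
    (h : ∀ x, |ψ x| ^ 2 ≤ A * (#{y | |ψ x| ≤ |ψ y|} : ℝ) ^ (-s)) :
    lpN p ψ ≤ Real.sqrt A * (∑' k : ℕ, ((k + 1 : ℕ) : ℝ) ^ (-(s * (p / 2)))) ^ (1 / p) := by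
  set r := s * (p / 2) with hr
  have hsum : Summable fun k : ℕ => ((k + 1 : ℕ) : ℝ) ^ (-r) :=
    (summable_nat_add_iff 1 (f := fun k : ℕ => (k : ℝ) ^ (-r))).2
      (Real.summable_nat_rpow.2 (by linarith))
  have h1 : ∑ x, |ψ x| ^ p ≤ A ^ (p / 2) * ∑' k : ℕ, ((k + 1 : ℕ) : ℝ) ^ (-r) := by
    calc ∑ x, |ψ x| ^ p ≤ ∑ x, A ^ (p / 2) * (#{y | |ψ x| ≤ |ψ y|} : ℝ) ^ (-r) := by
          refine Finset.sum_le_sum fun x _ => ?_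
          have h2 := Real.rpow_le_rpow (by positivity) (h x) (by positivity : 0 ≤ p / 2)
          rw [Real.mul_rpow hA (by positivity), ← Real.rpow_mul (by positivity),
            ← Real.rpow_natCast, ← Real.rpow_mul (abs_nonneg _)] at h2
          rwa [Nat.cast_ofNat, mul_div_cancel₀ p two_ne_zero, neg_mul, ← hr] at h2
      _ = A ^ (p / 2) * ∑ x, (#{y | |ψ x| ≤ |ψ y|} : ℝ) ^ (-r) := by rw [Finset.mul_sum]
      _ ≤ _ := by
          gcongr
          refine (sum_rank_le Finset.univ (fun x => |ψ x|) (fun k : ℕ => (k : ℝ) ^ (-r)) ?_).trans ?_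
          · intro a b ha hab
            refine Real.rpow_le_rpow_of_nonpos (by exact_mod_cast ha) (by exact_mod_cast hab) ?_
            linarith
          · exact hsum.sum_le_tsum _ fun _ _ => by positivity
  have h0 : 0 ≤ ∑' k : ℕ, ((k + 1 : ℕ) : ℝ) ^ (-r) := tsum_nonneg fun _ => by positivity
  have h2 := Real.rpow_le_rpow (by positivity) h1 (by positivity : 0 ≤ 1 / p)
  rw [Real.mul_rpow (by positivity) h0, ← Real.rpow_mul hA,
    show p / 2 * (1 / p) = 1 / 2 by field_simp, ← Real.sqrt_eq_rpow] at h2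
  exact h2

theorem statement0 (q : ℕ) (hq : 2 ≤ q) (c : ℝ → ℝ) (hc : ∀ δ : ℝ, 0 < δ → 0 < c δ)
    (p : ℝ) (hp : 2 < p) :
    ∃ C : ℝ, 0 < C ∧
      ∀ (V : Type) [Fintype V] [DecidableEq V] (G : SimpleGraph V) [DecidableRel G.Adj],
        G.IsRegularOfDegree (q + 1) →
        ∀ N : ℕ, 1 ≤ N → CondStar q G c N →
          ∀ (ψ : V → ℝ) (lam : ℝ), ψ ≠ 0 → (Tq q G ψ = fun x => lam * ψ x) →
            lpN p ψ ≤ C * lpN 2 ψ / Real.sqrt N := by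
  set Q : ℝ := (q : ℝ) ^ (-(1 / 4) : ℝ) with hQdef
  have hq2 : (2 : ℝ) ≤ q := by exact_mod_cast hq
  have hq0 : (0 : ℝ) < q := by linarith
  have hQ0 : 0 < Q := by positivity
  have hQ1 : Q < 1 := Real.rpow_lt_one_of_one_lt_of_neg (by linarith) (by norm_num)
  have hQ4 : Q ^ 4 = (q : ℝ)⁻¹ := by
    rw [hQdef, ← Real.rpow_natCast, ← Real.rpow_mul hq0.le]
    norm_num [Real.rpow_neg_one]
  have hQ2 : Q ^ 2 ≤ 3 / 4 := by
    have h : (q : ℝ)⁻¹ ≤ 2⁻¹ := inv_anti₀ (by norm_num) hq2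
    nlinarith
  set c₀ : ℝ := max 1 (c (1 / 4))
  have hc₀ : 1 ≤ c₀ := le_max_left _ _
  set K : ℝ := 4 * c₀ / Q ^ 2
  have hK : 1 ≤ K := by
    rw [le_div_iff₀ (by positivity)]
    linarith
  obtain ⟨j, hj⟩ : ∃ j : ℕ, ((1 : ℝ) / 2) ^ j < 1 - 2 / p :=
    exists_pow_lt_of_lt_one (by rw [sub_pos, div_lt_one] <;> linarith) (by norm_num)
  set σ : ℝ := ((2 ^ j : ℕ) : ℝ)⁻¹ with hσ
  have hσ' : σ < 1 - 2 / p := by simpa [hσ] using hj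
  have hσ0 : 0 < σ := by positivity
  have hR : 0 < 1 - Q ^ σ := sub_pos.2 (Real.rpow_lt_one hQ0.le hQ1 hσ0)
  have hp0 : 0 < p := by linarith
  have hs : 1 < (1 - σ) * (p / 2) := by
    have h : 2 / p < 1 - σ := by linarith
    rw [div_lt_iff₀ hp0] at h
    linarith
  set C₁ : ℝ := 512 * 2 ^ j * K ^ σ * (1 - Q ^ σ)⁻¹
  have hC₁ : 0 < C₁ := by positivity
  set Z : ℝ := ∑' k : ℕ, ((k + 1 : ℕ) : ℝ) ^ (-((1 - σ) * (p / 2)))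
  have hZ : 0 < Z := by
    have hsum : Summable fun k : ℕ => ((k + 1 : ℕ) : ℝ) ^ (-((1 - σ) * (p / 2))) :=
      (summable_nat_add_iff 1 (f := fun k : ℕ => (k : ℝ) ^ (-((1 - σ) * (p / 2))))).2
        (Real.summable_nat_rpow.2 (by linarith))
    exact hsum.tsum_pos (fun _ => by positivity) 0 (by positivity)
  refine ⟨Real.sqrt C₁ * Z ^ (1 / p), by positivity, ?_⟩
  intro V _ _ G _ _ N hN hstar ψ lam _ hψ
  have hKker : ∀ x y : V, ∀ n, 1 ≤ n → n ≤ N → |Kker q G n x y| ≤ c₀ * Q ^ n := by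
    intro x y n h1 h2
    refine (hstar (1 / 4) (by norm_num) n h1 h2 x y).trans ?_
    rw [Real.rpow_mul hq0.le, Real.rpow_natCast,
      show (-1 / 2 + 1 / 4 : ℝ) = -(1 / 4) by norm_num, ← hQdef]
    gcongr
    exact le_max_right _ _
  have hW : 0 ≤ ψ ⬝ᵥ ψ := Finset.sum_nonneg fun x _ => mul_self_nonneg _
  have hweak : ∀ x, |ψ x| ^ 2 ≤
      C₁ * (ψ ⬝ᵥ ψ) / N * (#{y | |ψ x| ≤ |ψ y|} : ℝ) ^ (-(1 - σ)) := by
    intro x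
    rw [neg_sub]
    exact sq_le_of_superlevel hQ0 hQ1 hK hN
      (fun n h1 h2 x y => abs_aeval_T_le hQ0 hQ4 hQ2 hc₀ (hKker x y) n h1 h2) hψ
      ⟨x, by simp⟩ (abs_nonneg _) (by simp) j
  refine (lpN_le_of_superlevel hp0 hs (by positivity) hweak).trans (le_of_eq ?_)
  have h2 : lpN 2 ψ = Real.sqrt (ψ ⬝ᵥ ψ) := by
    rw [lpN, Real.sqrt_eq_rpow]
    congr 1
    exact Finset.sum_congr rfl fun x _ => by
      rw [Real.rpow_two, sq_abs, sq]
  rw [h2, Real.sqrt_div (by positivity), Real.sqrt_mul hC₁.le]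
  ring
end

section
/- Let q ≥ 2 be an integer, β > 0, C₀ > 0 and p > 2. There exists a constant C = C(q, β, C₀, p) > 0 such that the following holds. Let G be any finite (q+1)-regular Ramanujan graph with vertex set V, and let N be an integer with 1 ≤ N ≤ log_q |V| such that Condition (★★) holds with constants β, C₀ and the integer N. Then every eigenfunction ψ of T_q whose eigenvalue lies in [−2, 2] satisfies ‖ψ‖_p ≤ C · ‖ψ‖_2 / √N. -/
open Finset

/-- Condition (★★): `max_{x,y} |K_n(x,y)| ≤ C₀ · q^{-βn}` for all `1 ≤ n ≤ N`. -/
def CondStarStar {V : Type*} [Fintype V] [DecidableEq V] (q : ℕ) (G : SimpleGraph V)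
    [DecidableRel G.Adj] (β C₀ : ℝ) (N : ℕ) : Prop :=
  ∀ n : ℕ, 1 ≤ n → n ≤ N → ∀ x y : V,
    |Kker q G n x y| ≤ C₀ * (q : ℝ) ^ (-(β * (n : ℝ)))

/-- `G` is Ramanujan: the spectrum of `T_q` is contained in `[-2,2] ∪ {(q+1)/√q}`, and the
eigenspace of the eigenvalue `(q+1)/√q` consists exactly of the constant functions. -/
def IsRamanujan {V : Type*} [Fintype V] (q : ℕ) (G : SimpleGraph V)
    [DecidableRel G.Adj] : Prop :=
  (∀ (f : V → ℝ) (lam : ℝ), f ≠ 0 → (Tq q G f = fun x => lam * f x) →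
      lam ∈ Set.Icc (-2 : ℝ) 2 ∨ lam = ((q : ℝ) + 1) / Real.sqrt q) ∧
  (∀ f : V → ℝ, (Tq q G f = fun x => ((q : ℝ) + 1) / Real.sqrt q * f x) →
      ∃ a : ℝ, f = fun _ => a)

open Polynomial.Chebyshev

section Chebyshev

lemma Polynomial.Chebyshev.C_eq_S_sub_S (R : Type*) [CommRing R] (n : ℤ) :
    C R n = S R n - S R (n - 2) := by
  rw [C_eq_S_sub_X_mul_S, S_sub_two]
  ring

lemma Polynomial.Chebyshev.C_eval_add_inv {F : Type*} [Field F] {s : F} (hs : s ≠ 0) (n : ℕ) :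
    (C F n).eval (s + s⁻¹) = s ^ n + s⁻¹ ^ n := by
  induction n using Nat.twoStepInduction with
  | zero => simp; norm_num
  | one => simp
  | more n ih₀ ih₁ =>
    push_cast at ih₁ ⊢
    rw [C_add_two, Polynomial.eval_sub, Polynomial.eval_mul, Polynomial.eval_X, ih₀, ih₁]
    have h : s * s⁻¹ = 1 := mul_inv_cancel₀ hs
    linear_combination (s ^ n + s⁻¹ ^ n) * h

lemma exists_two_mul_cos_eq {a : ℝ} (ha : |a| ≤ 2) : ∃ θ : ℝ, 2 * Real.cos θ = a := by
  obtain ⟨h₁, h₂⟩ := abs_le.1 ha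
  refine ⟨Real.arccos (a / 2), ?_⟩
  rw [Real.cos_arccos (by linarith) (by linarith)]
  ring

lemma abs_C_eval_le_two {a : ℝ} (ha : |a| ≤ 2) (n : ℤ) : |(C ℝ n).eval a| ≤ 2 := by
  obtain ⟨θ, rfl⟩ := exists_two_mul_cos_eq ha
  rw [C_two_mul_real_cos, abs_mul, abs_two]
  linarith [Real.abs_cos_le_one (n * θ)]

lemma sum_sum_cos_sub (N : ℕ) (θ : ℝ) :
    ∑ j ∈ range N, ∑ k ∈ range N, Real.cos (((j : ℤ) - (k : ℤ) : ℤ) * θ) =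
      (∑ j ∈ range N, Real.cos (j * θ)) ^ 2 + (∑ j ∈ range N, Real.sin (j * θ)) ^ 2 := by
  simp_rw [sq, sum_mul_sum, ← sum_add_distrib]
  refine sum_congr rfl fun j _ => sum_congr rfl fun k _ => ?_
  push_cast
  rw [sub_mul, Real.cos_sub]

lemma sum_sum_C_mul_C_eq (N : ℕ) (θ φ : ℝ) :
    ∑ j ∈ range N, ∑ k ∈ range N, (C ℝ ((j : ℤ) - k)).eval (2 * Real.cos θ) *
        (C ℝ ((j : ℤ) - k)).eval (2 * Real.cos φ) =
      2 * ((∑ j ∈ range N, Real.cos (j * (θ - φ))) ^ 2 +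
          (∑ j ∈ range N, Real.sin (j * (θ - φ))) ^ 2) +
        2 * ((∑ j ∈ range N, Real.cos (j * (θ + φ))) ^ 2 +
          (∑ j ∈ range N, Real.sin (j * (θ + φ))) ^ 2) := by
  rw [← sum_sum_cos_sub, ← sum_sum_cos_sub]
  simp_rw [mul_sum, ← sum_add_distrib]
  refine sum_congr rfl fun j _ => sum_congr rfl fun k _ => ?_
  rw [C_two_mul_real_cos, C_two_mul_real_cos, mul_sub, mul_add, Real.cos_sub, Real.cos_add]
  ring

lemma sum_sum_C_mul_C_nonneg (N : ℕ) {a b : ℝ} (ha : |a| ≤ 2) (hb : |b| ≤ 2) :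
    0 ≤ ∑ j ∈ range N, ∑ k ∈ range N,
      (C ℝ ((j : ℤ) - k)).eval a * (C ℝ ((j : ℤ) - k)).eval b := by
  obtain ⟨θ, rfl⟩ := exists_two_mul_cos_eq ha
  obtain ⟨φ, rfl⟩ := exists_two_mul_cos_eq hb
  rw [sum_sum_C_mul_C_eq]
  positivity

lemma two_mul_sq_le_sum_sum_C_mul_C (N : ℕ) {a : ℝ} (ha : |a| ≤ 2) :
    2 * (N : ℝ) ^ 2 ≤ ∑ j ∈ range N, ∑ k ∈ range N,
      (C ℝ ((j : ℤ) - k)).eval a * (C ℝ ((j : ℤ) - k)).eval a := by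
  obtain ⟨θ, rfl⟩ := exists_two_mul_cos_eq ha
  rw [sum_sum_C_mul_C_eq]
  simp only [sub_self, mul_zero, Real.cos_zero, sum_const, card_range, nsmul_eq_mul, mul_one,
    Real.sin_zero]
  nlinarith [sq_nonneg (∑ j ∈ range N, Real.cos (j * (θ + θ))),
    sq_nonneg (∑ j ∈ range N, Real.sin (j * (θ + θ)))]

end Chebyshev

lemma sum_sum_natAbs_sub_le {a : ℕ → ℝ} (ha : ∀ n, 0 ≤ a n) (N : ℕ) :
    ∑ j ∈ range N, ∑ k ∈ range N, a ((j : ℤ) - k).natAbs ≤ 2 * N * ∑ n ∈ range N, a n := by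
  have row (j : ℕ) (hj : j ∈ range N) :
      ∑ k ∈ range N, a ((j : ℤ) - k).natAbs ≤ 2 * ∑ n ∈ range N, a n := by
    rw [mem_range] at hj
    have hsplit : ∑ k ∈ range N, a ((j : ℤ) - k).natAbs =
        ∑ k ∈ range j, a (j - k) + ∑ k ∈ range (N - j), a k := by
      rw [← Finset.sum_range_add_sum_Ico _ hj.le, Finset.sum_Ico_eq_sum_range]
      congr 1
      · refine sum_congr rfl fun k hk => ?_
        rw [mem_range] at hk
        congr 1
        omega
      · refine sum_congr rfl fun k hk => ?_
        congr 1
        omega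
    have h₁ : ∑ k ∈ range j, a (j - k) ≤ ∑ n ∈ range N, a n := by
      have : ∑ k ∈ range j, a (j - k) = ∑ k ∈ range j, a (k + 1) := by
        rw [← Finset.sum_range_reflect]
        refine sum_congr rfl fun k hk => ?_
        rw [mem_range] at hk
        congr 1
        omega
      rw [this]
      calc ∑ k ∈ range j, a (k + 1) ≤ ∑ k ∈ range (j + 1), a k := by
            rw [Finset.sum_range_succ']
            linarith [ha 0]
        _ ≤ _ := sum_le_sum_of_subset_of_nonneg (range_subset_range.2 hj) fun _ _ _ => ha _
    have h₂ : ∑ k ∈ range (N - j), a k ≤ ∑ n ∈ range N, a n :=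
      sum_le_sum_of_subset_of_nonneg (range_subset_range.2 (Nat.sub_le _ _)) fun _ _ _ => ha _
    linarith
  calc _ ≤ ∑ j ∈ range N, 2 * ∑ n ∈ range N, a n := sum_le_sum row
    _ = _ := by rw [sum_const, card_range, nsmul_eq_mul]; ring

lemma sum_range_pow_le {ρ : ℝ} (h₀ : 0 ≤ ρ) (h₁ : ρ < 1) (N : ℕ) :
    ∑ n ∈ range N, ρ ^ n ≤ (1 - ρ)⁻¹ := by
  rw [← tsum_geometric_of_lt_one h₀ h₁]
  exact (summable_geometric_of_lt_one h₀ h₁).sum_le_tsum _ fun _ _ => by positivity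

section Interpolation

open Matrix

variable {V : Type*} [Fintype V]

lemma abs_dotProduct_mulVec_le {Q : Matrix V V ℝ} {K : ℝ} (hQ : ∀ x y, |Q x y| ≤ K)
    (f : V → ℝ) : |f ⬝ᵥ Q *ᵥ f| ≤ K * (∑ x, |f x|) ^ 2 := by
  simp only [dotProduct, mulVec]
  calc _ ≤ ∑ x, |f x * ∑ y, Q x y * f y| := abs_sum_le_sum_abs _ _
    _ ≤ ∑ x, |f x| * ∑ y, K * |f y| := by
      refine sum_le_sum fun x _ => ?_
      rw [abs_mul]
      gcongr
      refine (abs_sum_le_sum_abs _ _).trans (sum_le_sum fun y _ => ?_)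
      rw [abs_mul]
      gcongr
      exact hQ x y
    _ = _ := by rw [← sum_mul, ← mul_sum]; ring

/-- A quantitative real interpolation between `ℓ¹ → ℓ^∞` and `ℓ² → ℓ²` bounds, obtained by
truncating `f` at height `t`. -/
lemma abs_quadForm_le_of_interpolation {Q : Matrix V V ℝ} {K : ℝ}
    (hK : 0 ≤ K) (hQ : ∀ x y, |Q x y| ≤ K)
    (hQ₂ : ∀ f g : V → ℝ, |f ⬝ᵥ Q *ᵥ g| ≤ 2 * (√(∑ x, f x ^ 2) * √(∑ x, g x ^ 2)))
    {r : ℝ} (hr₁ : 1 ≤ r) (hr₂ : r < 2) {t : ℝ} (ht₀ : 0 < t) (ht₁ : t ≤ 1)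
    {f : V → ℝ} (hf : ∑ x, |f x| ^ r ≤ 1) :
    |f ⬝ᵥ Q *ᵥ f| ≤ K * t⁻¹ ^ 2 + 4 * t ^ (1 - r / 2) := by
  have hf_le (x : V) : |f x| ≤ 1 := by
    have h : |f x| ^ r ≤ 1 :=
      (single_le_sum (f := fun x => |f x| ^ r) (fun _ _ => by positivity) (mem_univ x)).trans hf
    by_contra! hx
    exact absurd h (not_le.2 (Real.one_lt_rpow hx (by linarith)))
  let f₁ : V → ℝ := fun x => if t < |f x| then f x else 0
  let f₂ : V → ℝ := fun x => if t < |f x| then 0 else f x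
  have hadd : f = f₁ + f₂ := by
    ext x
    simp only [f₁, f₂, Pi.add_apply]
    split_ifs <;> simp
  have hsq (x : V) : f x ^ 2 ≤ |f x| ^ r := by
    rw [← sq_abs, ← Real.rpow_natCast]
    rcases (abs_nonneg (f x)).eq_or_lt with h | h
    · rw [← h, Real.zero_rpow (by norm_num), Real.zero_rpow (by linarith)]
    · exact Real.rpow_le_rpow_of_exponent_ge h (hf_le x) (by push_cast; linarith)
  have hfl2 : √(∑ x, f x ^ 2) ≤ 1 :=
    Real.sqrt_le_one.2 ((sum_le_sum fun x _ => hsq x).trans hf)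
  have hf₁l2 : √(∑ x, f₁ x ^ 2) ≤ 1 := by
    refine Real.sqrt_le_one.2 ((sum_le_sum fun x _ => ?_).trans hf)
    simp only [f₁]
    split_ifs
    · exact hsq x
    · simpa using by positivity
  have hf₂l2 : √(∑ x, f₂ x ^ 2) ≤ t ^ (1 - r / 2) := by
    refine Real.sqrt_le_iff.2 ⟨by positivity, ?_⟩
    have key (x : V) : f₂ x ^ 2 ≤ t ^ (2 - r) * |f x| ^ r := by
      simp only [f₂]
      split_ifs with h
      · simpa using by positivity
      · rcases (abs_nonneg (f x)).eq_or_lt with h0 | h0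
        · rw [abs_eq_zero.1 h0.symm]
          simpa using by positivity
        · calc f x ^ 2 = |f x| ^ (2 - r) * |f x| ^ r := by
                rw [← Real.rpow_add h0, sub_add_cancel, Real.rpow_two, sq_abs]
            _ ≤ _ := by
              gcongr
              exact not_lt.1 h
    calc ∑ x, f₂ x ^ 2 ≤ ∑ x, t ^ (2 - r) * |f x| ^ r := sum_le_sum fun x _ => key x
      _ ≤ t ^ (2 - r) * 1 := by
        rw [← mul_sum]
        gcongr
      _ = _ := by
        rw [mul_one, ← Real.rpow_natCast, ← Real.rpow_mul ht₀.le]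
        congr 1
        push_cast
        ring
  have hf₁l1 : ∑ x, |f₁ x| ≤ t⁻¹ := by
    have key (x : V) : |f₁ x| ≤ t⁻¹ * |f x| ^ r := by
      simp only [f₁]
      split_ifs with h
      · rw [inv_mul_eq_div, le_div_iff₀ ht₀]
        calc |f x| * t ≤ |f x| ^ (1 : ℝ) * |f x| ^ (r - 1) := by
              rw [Real.rpow_one]
              gcongr
              calc t ≤ t ^ (r - 1) := by
                    simpa using Real.rpow_le_rpow_of_exponent_ge ht₀ ht₁
                      (show r - 1 ≤ 1 by linarith)
                _ ≤ _ := Real.rpow_le_rpow ht₀.le h.le (by linarith)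
          _ = |f x| ^ r := by
            rw [← Real.rpow_add (ht₀.trans h)]
            congr 1
            ring
      · simpa using by positivity
    calc ∑ x, |f₁ x| ≤ ∑ x, t⁻¹ * |f x| ^ r := sum_le_sum fun x _ => key x
      _ ≤ t⁻¹ * 1 := by
        rw [← mul_sum]
        gcongr
      _ = _ := mul_one _
  have hdecomp : f ⬝ᵥ Q *ᵥ f = f₁ ⬝ᵥ Q *ᵥ f₁ + f₁ ⬝ᵥ Q *ᵥ f₂ + f₂ ⬝ᵥ Q *ᵥ f := by
    nth_rw 1 [hadd]
    rw [add_dotProduct, ← dotProduct_add, ← mulVec_add, ← hadd]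
  have h₁₁ : |f₁ ⬝ᵥ Q *ᵥ f₁| ≤ K * t⁻¹ ^ 2 :=
    (abs_dotProduct_mulVec_le hQ f₁).trans (by gcongr)
  have h₁₂ : |f₁ ⬝ᵥ Q *ᵥ f₂| ≤ 2 * (1 * t ^ (1 - r / 2)) :=
    (hQ₂ f₁ f₂).trans (by gcongr)
  have h₂ : |f₂ ⬝ᵥ Q *ᵥ f| ≤ 2 * (t ^ (1 - r / 2) * 1) :=
    (hQ₂ f₂ f).trans (by gcongr)
  rw [hdecomp]
  linarith [abs_add_three (f₁ ⬝ᵥ Q *ᵥ f₁) (f₁ ⬝ᵥ Q *ᵥ f₂) (f₂ ⬝ᵥ Q *ᵥ f)]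

end Interpolation

section Spectral

open Matrix

variable {V : Type*} [Fintype V]

/-- The coefficients `⟨v i, f⟩` of `f` along a family of functions `v`. -/
def coeffs (v : V → V → ℝ) (f : V → ℝ) (i : V) : ℝ := ∑ x, v i x * f x

/-- The kernel `∑ i, w i • v i ⊗ v i`. -/
def spectralKernel (v : V → V → ℝ) (w : V → ℝ) : Matrix V V ℝ :=
  fun x y => ∑ i, w i * (v i x * v i y)

lemma dotProduct_spectralKernel_mulVec (v : V → V → ℝ) (w f g : V → ℝ) :
    f ⬝ᵥ spectralKernel v w *ᵥ g = ∑ i, w i * (coeffs v f i * coeffs v g i) := by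
  simp only [coeffs, sum_mul_sum]
  simp only [dotProduct, mulVec, spectralKernel, mul_sum, sum_mul]
  refine (sum_congr rfl fun x _ => sum_comm).trans (sum_comm.trans ?_)
  refine sum_congr rfl fun i _ => sum_congr rfl fun x _ => sum_congr rfl fun y _ => ?_
  ring

/-- `v` is an orthonormal basis of `ℓ²(V)`. -/
structure IsOrthonormalSystem [DecidableEq V] (v : V → V → ℝ) : Prop where
  orthonormal : ∀ i j, ∑ x, v i x * v j x = if i = j then 1 else 0
  complete : ∀ x y, ∑ i, v i x * v i y = if x = y then 1 else 0

namespace IsOrthonormalSystem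

variable [DecidableEq V] {v : V → V → ℝ}

lemma sum_coeffs_mul_coeffs (hv : IsOrthonormalSystem v) (f g : V → ℝ) :
    ∑ i, coeffs v f i * coeffs v g i = ∑ x, f x * g x := by
  have h := dotProduct_spectralKernel_mulVec v (fun _ => 1) f g
  simp only [one_mul] at h
  have h1 : spectralKernel v (fun _ => 1) = 1 := by
    ext x y
    simp [spectralKernel, hv.complete, Matrix.one_apply]
  rw [← h, h1, one_mulVec]
  rfl

lemma sum_coeffs_sq (hv : IsOrthonormalSystem v) (f : V → ℝ) :
    ∑ i, coeffs v f i ^ 2 = ∑ x, f x ^ 2 := by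
  simpa only [sq] using hv.sum_coeffs_mul_coeffs f f

lemma abs_dotProduct_spectralKernel_mulVec_le (hv : IsOrthonormalSystem v) {w : V → ℝ} {B : ℝ}
    (hB : 0 ≤ B) (hw : ∀ i, |w i| ≤ B) (f g : V → ℝ) :
    |f ⬝ᵥ spectralKernel v w *ᵥ g| ≤ B * (√(∑ x, f x ^ 2) * √(∑ x, g x ^ 2)) := by
  rw [dotProduct_spectralKernel_mulVec, ← hv.sum_coeffs_sq f, ← hv.sum_coeffs_sq g]
  calc _ ≤ ∑ i, |w i * (coeffs v f i * coeffs v g i)| := abs_sum_le_sum_abs _ _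
    _ ≤ ∑ i, B * (|coeffs v f i| * |coeffs v g i|) := by
      refine sum_le_sum fun i _ => ?_
      rw [abs_mul, abs_mul]
      gcongr
      exact hw i
    _ ≤ _ := by
      rw [← mul_sum]
      gcongr
      simpa only [sq_abs] using Real.sum_mul_le_sqrt_mul_sqrt univ
        (fun i => |coeffs v f i|) fun i => |coeffs v g i|

end IsOrthonormalSystem

lemma exists_orthonormal_eigenbasis_Tq [DecidableEq V] (q : ℕ) (G : SimpleGraph V)
    [DecidableRel G.Adj] :
    ∃ (v : V → V → ℝ) (μ : V → ℝ), IsOrthonormalSystem v ∧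
      ∀ i, Tq q G (v i) = fun x => μ i * v i x := by
  have hA : ((√(q : ℝ))⁻¹ • G.adjMatrix ℝ).IsHermitian := by
    ext x y
    simp [SimpleGraph.adjMatrix_apply, G.adj_comm]
  refine ⟨fun i => hA.eigenvectorBasis i, hA.eigenvalues, ⟨fun i j => ?_, fun x y => ?_⟩,
    fun i => ?_⟩
  · have h := orthonormal_iff_ite.1 hA.eigenvectorBasis.orthonormal i j
    rw [← h, PiLp.inner_apply]
    simp [mul_comm]
  · have h := congrFun₂ (Unitary.coe_mul_star_self hA.eigenvectorUnitary) x y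
    simpa [Matrix.mul_apply, Matrix.one_apply] using h
  · have h := hA.mulVec_eigenvectorBasis i
    ext x
    have hx := congrFun h x
    simpa [Tq, Matrix.smul_mulVec, SimpleGraph.adjMatrix_mulVec_apply] using hx

lemma Tq_sum_smul (q : ℕ) (G : SimpleGraph V) [DecidableRel G.Adj] {v : V → V → ℝ} {μ : V → ℝ}
    (hμ : ∀ i, Tq q G (v i) = fun x => μ i * v i x) (c : V → ℝ) :
    Tq q G (fun x => ∑ i, c i * v i x) = fun x => ∑ i, c i * μ i * v i x := by
  ext x
  simp only [Tq]
  rw [sum_comm, mul_sum]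
  refine sum_congr rfl fun i _ => ?_
  have h := congrFun (hμ i) x
  simp only [Tq] at h
  rw [← mul_sum, mul_left_comm, h, mul_assoc]

/-- The scalar by which `S_n` acts on an eigenfunction of `T_q` with eigenvalue `a`. -/
noncomputable def sphereEigenvalue (q : ℕ) : ℕ → ℝ → ℝ
  | 0, _ => 1
  | 1, a => a
  | n + 2, a => (S ℝ ((n : ℤ) + 2)).eval a - (S ℝ (n : ℤ)).eval a / q

lemma Sop_sum_smul (q : ℕ) (G : SimpleGraph V) [DecidableRel G.Adj] {v : V → V → ℝ} {μ : V → ℝ}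
    (hμ : ∀ i, Tq q G (v i) = fun x => μ i * v i x) (c : V → ℝ) :
    ∀ n, Sop q G n (fun x => ∑ i, c i * v i x) =
      fun x => ∑ i, c i * sphereEigenvalue q n (μ i) * v i x
  | 0 => by simp [Sop, sphereEigenvalue]
  | 1 => by simp [Sop, sphereEigenvalue, Tq_sum_smul q G hμ]
  | 2 => by
    ext x
    simp only [Sop, Tq_sum_smul q G hμ, sphereEigenvalue, mul_sum, ← sum_sub_distrib]
    refine sum_congr rfl fun i _ => ?_
    simp [S_two]
    ring
  | n + 3 => by
    ext x
    simp only [Sop, Sop_sum_smul q G hμ c (n + 2), Sop_sum_smul q G hμ c (n + 1),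
      Tq_sum_smul q G hμ, ← sum_sub_distrib]
    refine sum_congr rfl fun i _ => ?_
    have h : sphereEigenvalue q (n + 3) (μ i) =
        μ i * sphereEigenvalue q (n + 2) (μ i) - sphereEigenvalue q (n + 1) (μ i) := by
      cases n with
      | zero =>
        have h3 := S_add_two ℝ 1
        norm_num at h3
        simp [sphereEigenvalue, h3, S_two]
        ring
      | succ m =>
        simp only [sphereEigenvalue]
        have h4 := congrArg (Polynomial.eval (μ i)) (S_add_two ℝ ((m : ℤ) + 2))
        have h2 := congrArg (Polynomial.eval (μ i)) (S_add_two ℝ (m : ℤ))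
        simp only [Polynomial.eval_sub, Polynomial.eval_mul, Polynomial.eval_X] at h2 h4
        push_cast
        ring_nf at h2 h4 ⊢
        linear_combination h4 - h2 * (q : ℝ)⁻¹
    rw [h]
    ring

lemma Kker_eq_spectralKernel [DecidableEq V] (q : ℕ) (G : SimpleGraph V) [DecidableRel G.Adj]
    {v : V → V → ℝ} {μ : V → ℝ} (hv : IsOrthonormalSystem v)
    (hμ : ∀ i, Tq q G (v i) = fun x => μ i * v i x) (n : ℕ) (x y : V) :
    Kker q G n x y = spectralKernel v (fun i => sphereEigenvalue q n (μ i)) x y := by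
  have h : (fun z => if z = y then (1 : ℝ) else 0) = fun z => ∑ i, v i y * v i z := by
    ext z
    rw [hv.complete, if_congr eq_comm rfl rfl]
  rw [Kker, h, Sop_sum_smul q G hμ]
  simp only [spectralKernel]
  refine sum_congr rfl fun i _ => ?_
  ring

end Spectral

section KernelBounds

open Matrix

variable {V : Type*} [Fintype V]

lemma spectralKernel_sub (v : V → V → ℝ) (w w' : V → ℝ) (x y : V) :
    spectralKernel v (fun i => w i - w' i) x y =
      spectralKernel v w x y - spectralKernel v w' x y := by
  simp [spectralKernel, sub_mul]

lemma spectralKernel_add_div (v : V → V → ℝ) (w w' : V → ℝ) (a : ℝ) (x y : V) :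
    spectralKernel v (fun i => w i + w' i / a) x y =
      spectralKernel v w x y + spectralKernel v w' x y / a := by
  simp [spectralKernel, add_mul, sum_add_distrib, sum_div, div_mul_eq_mul_div]

/-- Bounds on the kernels `K_n` pass to the kernels of the Chebyshev polynomials `S_n(T_q)`. -/
lemma abs_spectralKernel_S_le [DecidableEq V] {v : V → V → ℝ} (hv : IsOrthonormalSystem v)
    {μ : V → ℝ} {q : ℕ} (hq : 2 ≤ q) {ρ C₀ : ℝ} (hC₀ : 0 ≤ C₀) (hρ₀ : 0 < ρ)
    (hqρ : 1 ≤ q * ρ ^ 4) {N : ℕ}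
    (hK : ∀ n, 1 ≤ n → n ≤ N → ∀ x y,
      |spectralKernel v (fun i => sphereEigenvalue q n (μ i)) x y| ≤ C₀ * ρ ^ n) :
    ∀ n ≤ N, ∀ x y,
      |spectralKernel v (fun i => (S ℝ (n : ℤ)).eval (μ i)) x y| ≤ (4 * C₀ + 4) * ρ ^ n := by
  have hq2 : (2 : ℝ) ≤ q := mod_cast hq
  have hq0 : (0 : ℝ) < q := by linarith
  intro n
  induction n using Nat.twoStepInduction with
  | zero =>
    intro _ x y
    simp only [spectralKernel, Nat.cast_zero, S_zero, Polynomial.eval_one, one_mul, hv.complete,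
      pow_zero, mul_one]
    split_ifs
    · rw [abs_one]; linarith
    · rw [abs_zero]; linarith
  | one =>
    intro hn x y
    have h := hK 1 le_rfl hn x y
    simp only [sphereEigenvalue] at h
    simp only [Nat.cast_one, S_one, Polynomial.eval_X]
    exact h.trans (by gcongr; linarith)
  | more n ih _ =>
    intro hn x y
    have h := hK (n + 2) (by omega) hn x y
    have ih := ih (by omega) x y
    have heq : (fun i => (S ℝ ((n + 2 : ℕ) : ℤ)).eval (μ i)) =
        fun i => sphereEigenvalue q (n + 2) (μ i) + (S ℝ (n : ℤ)).eval (μ i) / q := by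
      ext i
      simp [sphereEigenvalue]
    rw [heq, spectralKernel_add_div]
    have hs : (4 : ℝ) / 3 ≤ q * ρ ^ 2 := by
      have : 2 ≤ (q * ρ ^ 2) ^ 2 := by nlinarith
      nlinarith [show 0 < q * ρ ^ 2 by positivity]
    calc _ ≤ C₀ * ρ ^ (n + 2) + (4 * C₀ + 4) * ρ ^ n / q := by
          refine (abs_add_le _ _).trans (add_le_add h ?_)
          rw [abs_div, abs_of_pos hq0]
          gcongr
      _ ≤ C₀ * ρ ^ (n + 2) + (4 * C₀ + 4) * ρ ^ n * (3 / 4 * ρ ^ 2) := by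
          rw [div_eq_mul_inv]
          gcongr
          rw [inv_le_iff_one_le_mul₀ hq0]
          linarith
      _ = (4 * C₀ + 3) * ρ ^ (n + 2) := by ring
      _ ≤ _ := by gcongr; linarith

/-- The kernel of the Chebyshev polynomial `C_n(T_q)`. -/
lemma abs_spectralKernel_C_le [DecidableEq V] {v : V → V → ℝ} (hv : IsOrthonormalSystem v)
    {μ : V → ℝ} {ρ B : ℝ} (hρ₀ : 0 < ρ) (hB : 1 ≤ B) {N : ℕ}
    (hS : ∀ n ≤ N, ∀ x y,
      |spectralKernel v (fun i => (S ℝ (n : ℤ)).eval (μ i)) x y| ≤ B * ρ ^ n)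
    {n : ℕ} (hn : n ≤ N) (x y : V) :
    |spectralKernel v (fun i => (C ℝ (n : ℤ)).eval (μ i)) x y| ≤
      2 * B * (1 + ρ⁻¹ ^ 2) * ρ ^ n := by
  have hρ2 : 0 < ρ⁻¹ ^ 2 := by positivity
  match n with
  | 0 =>
    simp only [spectralKernel, Nat.cast_zero, C_zero, ← mul_sum, hv.complete,
      pow_zero, mul_one, Polynomial.eval_ofNat]
    split_ifs
    · rw [mul_one, abs_two]; nlinarith
    · rw [mul_zero, abs_zero]; positivity
  | 1 =>
    have h := hS 1 hn x y
    simp only [Nat.cast_one, S_one] at h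
    simp only [Nat.cast_one, C_one]
    refine h.trans ?_
    gcongr
    nlinarith
  | n + 2 =>
    have h₀ := hS n (by omega) x y
    have h₂ := hS (n + 2) hn x y
    have heq : (fun i => (C ℝ ((n + 2 : ℕ) : ℤ)).eval (μ i)) =
        fun i => (S ℝ ((n + 2 : ℕ) : ℤ)).eval (μ i) - (S ℝ (n : ℤ)).eval (μ i) := by
      ext i
      rw [C_eq_S_sub_S, Polynomial.eval_sub]
      push_cast
      rw [add_sub_cancel_right]
    rw [heq, spectralKernel_sub]
    calc _ ≤ B * ρ ^ (n + 2) + B * ρ ^ n := (abs_sub _ _).trans (add_le_add h₂ h₀)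
      _ = B * (1 + ρ⁻¹ ^ 2) * ρ ^ (n + 2) := by field_simp; ring
      _ ≤ _ := by
        have : 0 < B * (1 + ρ⁻¹ ^ 2) * ρ ^ (n + 2) := by positivity
        linarith

/-- The contribution of constant eigenfunctions to a kernel. -/
lemma IsOrthonormalSystem.abs_sum_filter_const_le [DecidableEq V] {v : V → V → ℝ}
    (hv : IsOrthonormalSystem v) (P : V → Prop) [DecidablePred P]
    (hP : ∀ i, P i → ∃ a : ℝ, v i = fun _ => a) (x y : V) :
    |∑ i with P i, v i x * v i y| ≤ (Fintype.card V : ℝ)⁻¹ := by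
  have hcard : (univ.filter P).card ≤ 1 := by
    refine card_le_one.2 fun i hi j hj => ?_
    obtain ⟨a, ha⟩ := hP i (mem_filter.1 hi).2
    obtain ⟨b, hb⟩ := hP j (mem_filter.1 hj).2
    by_contra hij
    have h₁ := hv.orthonormal i i
    have h₂ := hv.orthonormal j j
    have h₃ := hv.orthonormal i j
    simp only [ha, hb, sum_const, if_neg hij, if_true, nsmul_eq_mul] at h₁ h₂ h₃
    have : (1 : ℝ) = 0 := by
      linear_combination (-1 : ℝ) * h₂ - (card (univ : Finset V) * (b * b) : ℝ) * h₁ +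
        (card (univ : Finset V) * (a * b) : ℝ) * h₃
    exact one_ne_zero this
  rcases (univ.filter P).eq_empty_or_nonempty with h | ⟨i, hi⟩
  · rw [h, sum_empty, abs_zero]
    positivity
  · have hs : univ.filter P = {i} :=
      eq_singleton_iff_unique_mem.2 ⟨hi, fun j hj => card_le_one.1 hcard j hj i hi⟩
    obtain ⟨a, ha⟩ := hP i (mem_filter.1 hi).2
    have h₁ := hv.orthonormal i i
    simp only [ha, sum_const, if_true, nsmul_eq_mul, card_univ] at h₁
    rw [hs, sum_singleton, ha, abs_mul_self]
    exact (eq_inv_of_mul_eq_one_right h₁).le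

/-- The weights of `C_n(T_q)` on the part of the spectrum in `[-2, 2]`. -/
noncomputable def temperedWeight (μ : V → ℝ) (n : ℕ) (i : V) : ℝ :=
  if |μ i| ≤ 2 then (C ℝ (n : ℤ)).eval (μ i) else 0

lemma abs_spectralKernel_temperedWeight_le [DecidableEq V] {v : V → V → ℝ}
    (hv : IsOrthonormalSystem v) {μ : V → ℝ} {s ρ B : ℝ} (hs : 1 ≤ s) (hρ₀ : 0 < ρ)
    (hsρ : 1 ≤ s * ρ ^ 2)
    (hconst : ∀ i, ¬ |μ i| ≤ 2 → μ i = s + s⁻¹ ∧ ∃ a : ℝ, v i = fun _ => a)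
    {n : ℕ} (hcard : s ^ (2 * n) ≤ Fintype.card V)
    (hC : ∀ x y, |spectralKernel v (fun i => (C ℝ (n : ℤ)).eval (μ i)) x y| ≤ B * ρ ^ n)
    (x y : V) :
    |spectralKernel v (temperedWeight μ n) x y| ≤ (B + 2) * ρ ^ n := by
  have hs0 : 0 < s := by linarith
  have hsplit : spectralKernel v (temperedWeight μ n) x y =
      spectralKernel v (fun i => (C ℝ (n : ℤ)).eval (μ i)) x y -
        (s ^ n + s⁻¹ ^ n) * ∑ i with ¬ |μ i| ≤ 2, v i x * v i y := by
    rw [sum_filter, mul_sum]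
    simp only [spectralKernel, ← sum_sub_distrib]
    refine sum_congr rfl fun i _ => ?_
    by_cases hi : |μ i| ≤ 2
    · simp [temperedWeight, hi]
    · rw [if_pos hi, (hconst i hi).1, C_eval_add_inv hs0.ne', temperedWeight, if_neg hi]
      ring
  have htriv : (s ^ n + s⁻¹ ^ n) * (Fintype.card V : ℝ)⁻¹ ≤ 2 * ρ ^ n := by
    have h1 : s⁻¹ ^ n ≤ s ^ n :=
      pow_le_pow_left₀ (by positivity) ((inv_le_one_of_one_le₀ hs).trans hs) n
    calc _ ≤ (2 * s ^ n) * (s ^ (2 * n))⁻¹ := by gcongr; linarith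
      _ = 2 * s⁻¹ ^ n := by rw [two_mul n, pow_add, inv_pow]; field_simp
      _ ≤ 2 * ρ ^ n := by
        gcongr
        rw [inv_le_iff_one_le_mul₀ hs0]
        nlinarith
  rw [hsplit]
  calc _ ≤ B * ρ ^ n + (s ^ n + s⁻¹ ^ n) * (Fintype.card V : ℝ)⁻¹ := by
        refine (abs_sub _ _).trans (add_le_add (hC x y) ?_)
        rw [abs_mul, abs_of_pos (by positivity : 0 < s ^ n + s⁻¹ ^ n)]
        gcongr
        exact hv.abs_sum_filter_const_le _ (fun i hi => (hconst i hi).2) x y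
    _ ≤ _ := by linarith

end KernelBounds

section Eigenfunctions

open Matrix

variable {V : Type*} [Fintype V]

lemma sum_Tq_mul (q : ℕ) (G : SimpleGraph V) [DecidableRel G.Adj] (f g : V → ℝ) :
    ∑ x, Tq q G f x * g x = ∑ x, f x * Tq q G g x := by
  simp only [Tq, ← SimpleGraph.adjMatrix_mulVec_apply]
  calc _ = (√(q : ℝ))⁻¹ * (G.adjMatrix ℝ *ᵥ f ⬝ᵥ g) := by
        simp only [dotProduct, mul_sum, mul_assoc]
    _ = (√(q : ℝ))⁻¹ * (f ⬝ᵥ G.adjMatrix ℝ *ᵥ g) := by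
        rw [dotProduct_mulVec, ← mulVec_transpose, SimpleGraph.transpose_adjMatrix]
    _ = _ := by
        simp only [dotProduct, mul_sum, mul_left_comm]

lemma coeffs_eq_zero_of_ne (q : ℕ) (G : SimpleGraph V) [DecidableRel G.Adj] {v : V → V → ℝ}
    {μ : V → ℝ} (hμ : ∀ i, Tq q G (v i) = fun x => μ i * v i x) {ψ : V → ℝ} {a : ℝ}
    (hψ : Tq q G ψ = fun x => a * ψ x) {i : V} (hi : μ i ≠ a) : coeffs v ψ i = 0 := by
  have h := sum_Tq_mul q G (v i) ψ
  simp only [hμ, hψ, mul_assoc, mul_left_comm _ a, ← mul_sum] at h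
  exact (mul_eq_mul_right_iff.1 h).resolve_left hi

lemma sq_sum_mul_eigenfunction_le [DecidableEq V] (q : ℕ) (G : SimpleGraph V)
    [DecidableRel G.Adj] {v : V → V → ℝ}
    {μ : V → ℝ} (hv : IsOrthonormalSystem v) (hμ : ∀ i, Tq q G (v i) = fun x => μ i * v i x)
    {ψ : V → ℝ} {a : ℝ} (hψ : Tq q G ψ = fun x => a * ψ x) (f : V → ℝ) :
    (∑ x, f x * ψ x) ^ 2 ≤ (∑ i with μ i = a, coeffs v f i ^ 2) * ∑ x, ψ x ^ 2 := by
  rw [← hv.sum_coeffs_mul_coeffs, ← hv.sum_coeffs_sq ψ]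
  have h : ∑ i, coeffs v f i * coeffs v ψ i = ∑ i with μ i = a, coeffs v f i * coeffs v ψ i := by
    rw [sum_filter_of_ne]
    intro i _ hne
    by_contra hi
    exact hne (by rw [coeffs_eq_zero_of_ne q G hμ hψ hi, mul_zero])
  rw [h]
  refine (sum_mul_sq_le_sq_mul_sq _ _ _).trans ?_
  gcongr
  exact subset_univ _

/-- The Fejér kernel centred at `a`, applied to the tempered part of the spectrum, controls the
projection to the eigenspace of `a`. -/
lemma mul_sum_coeffs_sq_le {v : V → V → ℝ} {μ : V → ℝ} {f : V → ℝ} {N : ℕ} {e : ℕ → ℝ}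
    (he₀ : ∀ n, 0 ≤ e n)
    (he : ∀ n < N, |f ⬝ᵥ spectralKernel v (temperedWeight μ n) *ᵥ f| ≤ e n)
    {a : ℝ} (ha : |a| ≤ 2) :
    (N : ℝ) ^ 2 * ∑ i with μ i = a, coeffs v f i ^ 2 ≤ 2 * N * ∑ n ∈ range N, e n := by
  have hW : ∑ j ∈ range N, ∑ k ∈ range N, (C ℝ ((j : ℤ) - k)).eval a *
      (f ⬝ᵥ spectralKernel v (temperedWeight μ ((j : ℤ) - k).natAbs) *ᵥ f) =
      ∑ i with |μ i| ≤ 2, (∑ j ∈ range N, ∑ k ∈ range N,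
        (C ℝ ((j : ℤ) - k)).eval a * (C ℝ ((j : ℤ) - k)).eval (μ i)) * coeffs v f i ^ 2 := by
    rw [sum_filter]
    simp only [dotProduct_spectralKernel_mulVec, mul_sum, sum_mul]
    refine (sum_congr rfl fun j _ => sum_comm).trans (sum_comm.trans ?_)
    refine sum_congr rfl fun i _ => ?_
    split_ifs with hi
    · refine sum_congr rfl fun j _ => sum_congr rfl fun k _ => ?_
      rw [temperedWeight, if_pos hi, C_natAbs]
      ring
    · simp [temperedWeight, hi]
  have hlower : 2 * (N : ℝ) ^ 2 * ∑ i with μ i = a, coeffs v f i ^ 2 ≤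
      ∑ i with |μ i| ≤ 2, (∑ j ∈ range N, ∑ k ∈ range N,
        (C ℝ ((j : ℤ) - k)).eval a * (C ℝ ((j : ℤ) - k)).eval (μ i)) * coeffs v f i ^ 2 := by
    rw [mul_sum]
    calc _ ≤ ∑ i with μ i = a, (∑ j ∈ range N, ∑ k ∈ range N,
          (C ℝ ((j : ℤ) - k)).eval a * (C ℝ ((j : ℤ) - k)).eval (μ i)) * coeffs v f i ^ 2 := by
          refine sum_le_sum fun i hi => ?_
          rw [(mem_filter.1 hi).2]
          gcongr
          exact two_mul_sq_le_sum_sum_C_mul_C N ha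
      _ ≤ _ := by
          refine sum_le_sum_of_subset_of_nonneg (fun i hi => ?_) fun i hi _ => ?_
          · rw [mem_filter] at hi ⊢
            exact ⟨hi.1, hi.2 ▸ ha⟩
          · exact mul_nonneg (sum_sum_C_mul_C_nonneg N ha (mem_filter.1 hi).2) (sq_nonneg _)
  have hupper : ∑ j ∈ range N, ∑ k ∈ range N, (C ℝ ((j : ℤ) - k)).eval a *
      (f ⬝ᵥ spectralKernel v (temperedWeight μ ((j : ℤ) - k).natAbs) *ᵥ f) ≤
      2 * ∑ j ∈ range N, ∑ k ∈ range N, e ((j : ℤ) - k).natAbs := by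
    simp only [mul_sum]
    refine sum_le_sum fun j hj => sum_le_sum fun k hk => ?_
    rw [mem_range] at hj hk
    refine (le_abs_self _).trans ?_
    rw [abs_mul]
    exact mul_le_mul (abs_C_eval_le_two ha _) (he _ (by omega)) (abs_nonneg _) zero_le_two
  have hsum := sum_sum_natAbs_sub_le he₀ N
  rw [← hW] at hlower
  linarith

lemma lpN_two_sq (f : V → ℝ) : lpN 2 f ^ 2 = ∑ x, f x ^ 2 := by
  rw [lpN, ← Real.sqrt_eq_rpow, Real.sq_sqrt (by positivity)]
  simp

/-- Duality for `ℓ^p` norms. -/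
lemma lpN_le_of_forall_sum_mul_le {p : ℝ} (hp : 1 < p) {ψ : V → ℝ} {E : ℝ} (hE : 0 ≤ E)
    (h : ∀ f : V → ℝ, ∑ x, |f x| ^ (p / (p - 1)) ≤ 1 → ∑ x, f x * ψ x ≤ E) :
    lpN p ψ ≤ E := by
  have hp0 : 0 < p := by linarith
  have hp1 : 0 < p - 1 := by linarith
  set M := ∑ x, |ψ x| ^ p with hM
  have hM0 : 0 ≤ M := by positivity
  rcases hM0.eq_or_lt with hM0 | hMpos
  · rw [lpN, ← hM, ← hM0, Real.zero_rpow (by positivity)]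
    exact hE
  have key := h (fun x => M ^ (1 / p - 1) * (|ψ x| ^ (p - 1) * SignType.sign (ψ x))) ?_
  · refine le_trans (le_of_eq ?_) key
    have hx (x : V) : M ^ (1 / p - 1) * (|ψ x| ^ (p - 1) * SignType.sign (ψ x)) * ψ x =
        M ^ (1 / p - 1) * |ψ x| ^ p := by
      rw [mul_assoc, mul_assoc, sign_mul_self]
      congr 1
      rcases (abs_nonneg (ψ x)).eq_or_lt with h0 | h0
      · rw [← h0, mul_zero, Real.zero_rpow hp0.ne']
      · rw [← Real.rpow_add_one h0.ne', sub_add_cancel]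
    simp only [hx, ← mul_sum, ← hM]
    rw [lpN, ← hM, ← Real.rpow_add_one hMpos.ne', sub_add_cancel]
  · have hx (x : V) :
        |M ^ (1 / p - 1) * (|ψ x| ^ (p - 1) * SignType.sign (ψ x))| ^ (p / (p - 1)) ≤
          M⁻¹ * |ψ x| ^ p := by
      have hsign : |((SignType.sign (ψ x) : SignType) : ℝ)| ≤ 1 := by
        rcases lt_trichotomy (ψ x) 0 with h | h | h <;> simp [h]
      rw [abs_mul, abs_mul, abs_of_nonneg (by positivity : 0 ≤ M ^ (1 / p - 1)),
        abs_of_nonneg (by positivity : 0 ≤ |ψ x| ^ (p - 1))]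
      calc _ ≤ (M ^ (1 / p - 1) * (|ψ x| ^ (p - 1) * 1)) ^ (p / (p - 1)) := by gcongr
        _ = M⁻¹ * |ψ x| ^ p := by
          rw [mul_one, Real.mul_rpow (by positivity) (by positivity),
            ← Real.rpow_mul hMpos.le, ← Real.rpow_mul (abs_nonneg _), ← Real.rpow_neg_one]
          congr 2 <;> field_simp
          ring
    calc _ ≤ ∑ x, M⁻¹ * |ψ x| ^ p := sum_le_sum fun x _ => hx x
      _ = 1 := by rw [← mul_sum, ← hM, inv_mul_cancel₀ hMpos.ne']

end Eigenfunctions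

lemma IsRamanujan.eq_and_const_of_not_abs_le_two {V : Type*} [Fintype V] [DecidableEq V] {q : ℕ}
    (hq : 2 ≤ q) {G : SimpleGraph V} [DecidableRel G.Adj] (hG : IsRamanujan q G)
    {v : V → V → ℝ} {μ : V → ℝ} (hv : IsOrthonormalSystem v)
    (hμ : ∀ i, Tq q G (v i) = fun x => μ i * v i x) (i : V) (hi : ¬ |μ i| ≤ 2) :
    μ i = √q + (√q)⁻¹ ∧ ∃ a : ℝ, v i = fun _ => a := by
  have hne : v i ≠ 0 := by
    intro h
    have h₁ := hv.orthonormal i i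
    simp [h] at h₁
  have hs : (√(q : ℝ)) ≠ 0 := by
    rw [Real.sqrt_ne_zero']
    exact_mod_cast (by omega : 0 < q)
  rcases hG.1 (v i) (μ i) hne (hμ i) with h | h
  · exact absurd (abs_le.2 h) hi
  · refine ⟨?_, hG.2 (v i) (by rw [hμ i, h])⟩
    rw [h, add_div, one_div]
    congr 1
    rw [div_eq_iff hs, Real.mul_self_sqrt (Nat.cast_nonneg q)]

/-- Exponential decay of the quadratic forms of `C_n(T_q)` on the tempered spectrum. -/
lemma abs_quadForm_temperedWeight_le {V : Type*} [Fintype V] [DecidableEq V] {q : ℕ}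
    (hq : 2 ≤ q) {G : SimpleGraph V} [DecidableRel G.Adj] (hG : IsRamanujan q G)
    {C₀ η : ℝ} (hC₀ : 0 ≤ C₀) (hη₀ : 0 < η) (hη₁ : η ≤ 1) (hqη : 1 ≤ q * (η ^ 4) ^ 4)
    {N : ℕ} (hN : (N : ℝ) ≤ Real.logb q (Fintype.card V)) (hcard : 0 < Fintype.card V)
    (hK : ∀ n, 1 ≤ n → n ≤ N → ∀ x y, |Kker q G n x y| ≤ C₀ * (η ^ 4) ^ n)
    {v : V → V → ℝ} {μ : V → ℝ} (hv : IsOrthonormalSystem v)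
    (hμ : ∀ i, Tq q G (v i) = fun x => μ i * v i x)
    {r : ℝ} (hr₁ : 1 ≤ r) (hr₂ : r < 2) {f : V → ℝ} (hf : ∑ x, |f x| ^ r ≤ 1)
    {n : ℕ} (hn : n ≤ N) :
    |f ⬝ᵥ (spectralKernel v (temperedWeight μ n)).mulVec f| ≤
      (2 * (4 * C₀ + 4) * (1 + (η ^ 4)⁻¹ ^ 2) + 2) * (η ^ 2) ^ n + 4 * (η ^ (1 - r / 2)) ^ n := by
  have hq2 : (2 : ℝ) ≤ q := mod_cast hq
  have hs : 1 ≤ √(q : ℝ) := Real.one_le_sqrt.2 (by linarith)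
  have hsq : √(q : ℝ) ^ 2 = q := Real.sq_sqrt (by linarith)
  have hsρ : 1 ≤ √(q : ℝ) * (η ^ 4) ^ 2 := by
    refine (one_le_sq_iff₀ (by positivity)).1 ?_
    rw [mul_pow, hsq]
    exact hqη.trans_eq (by ring)
  have hqN : (q : ℝ) ^ N ≤ Fintype.card V := by
    rw [Real.le_logb_iff_rpow_le (by linarith) (mod_cast hcard)] at hN
    simpa using hN
  have hsn : √(q : ℝ) ^ (2 * n) ≤ Fintype.card V := by
    rw [pow_mul, hsq]
    exact (pow_le_pow_right₀ (by linarith) hn).trans hqN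
  have hS := abs_spectralKernel_S_le hv (μ := μ) hq hC₀ (by positivity : 0 < η ^ 4) hqη
    (N := N) fun n h₁ h₂ x y => by
      rw [← Kker_eq_spectralKernel q G hv hμ]
      exact hK n h₁ h₂ x y
  have hQ := abs_spectralKernel_temperedWeight_le hv hs (by positivity) hsρ
    (hG.eq_and_const_of_not_abs_le_two hq hv hμ) hsn
    (abs_spectralKernel_C_le hv (by positivity) (by linarith) hS hn)
  have hw (i : V) : |temperedWeight μ n i| ≤ 2 := by
    rw [temperedWeight]
    split_ifs with hi
    · exact abs_C_eval_le_two hi n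
    · simp
  refine (abs_quadForm_le_of_interpolation (by positivity) hQ
    (hv.abs_dotProduct_spectralKernel_mulVec_le zero_le_two hw) hr₁ hr₂
    (pow_pos hη₀ n) (pow_le_one₀ hη₀.le hη₁) hf).trans_eq ?_
  have hpow : (η ^ 4) ^ n * (η ^ n)⁻¹ ^ 2 = (η ^ 2) ^ n := by
    rw [← pow_mul, inv_pow, ← pow_mul, ← pow_mul, show 4 * n = 2 * n + n * 2 by ring, pow_add,
      mul_assoc, mul_inv_cancel₀ (by positivity), mul_one]
  rw [mul_assoc, hpow, Real.rpow_pow_comm hη₀.le]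

theorem statement2 (q : ℕ) (hq : 2 ≤ q) (β C₀ : ℝ) (hβ : 0 < β) (hC₀ : 0 < C₀)
    (p : ℝ) (hp : 2 < p) :
    ∃ C : ℝ, 0 < C ∧
      ∀ (V : Type) [Fintype V] [DecidableEq V] (G : SimpleGraph V) [DecidableRel G.Adj],
        G.IsRegularOfDegree (q + 1) → IsRamanujan q G →
        ∀ N : ℕ, 1 ≤ N → (N : ℝ) ≤ Real.logb q (Fintype.card V) →
          CondStarStar q G β C₀ N →
          ∀ (ψ : V → ℝ) (lam : ℝ), ψ ≠ 0 → (Tq q G ψ = fun x => lam * ψ x) →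
            lam ∈ Set.Icc (-2 : ℝ) 2 →
            lpN p ψ ≤ C * lpN 2 ψ / Real.sqrt N := by
  have hq2 : (2 : ℝ) ≤ q := mod_cast hq
  have hq1 : (1 : ℝ) < q := by linarith
  set γ := min β (1 / 4) with hγ
  have hγ0 : 0 < γ := lt_min hβ (by norm_num)
  set η : ℝ := (q : ℝ) ^ (-(γ / 4)) with hη
  have hη₀ : 0 < η := by positivity
  have hη₁ : η < 1 := Real.rpow_lt_one_of_one_lt_of_neg hq1 (by linarith)
  have hη4 : η ^ 4 = (q : ℝ) ^ (-γ) := by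
    rw [hη, ← Real.rpow_natCast, ← Real.rpow_mul (by linarith)]
    congr 1
    push_cast
    ring
  have hqη : 1 ≤ q * (η ^ 4) ^ 4 := by
    rw [hη4, ← Real.rpow_natCast, ← Real.rpow_mul (by linarith), mul_comm,
      ← Real.rpow_add_one (by linarith)]
    refine Real.one_le_rpow hq1.le ?_
    push_cast
    linarith [min_le_right β (1 / 4)]
  set r := p / (p - 1) with hr
  have hr₁ : 1 ≤ r := (one_le_div (by linarith)).2 (by linarith)
  have hr₂ : r < 2 := (div_lt_iff₀ (by linarith)).2 (by linarith)
  set κ := η ^ (1 - r / 2) with hκ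
  have hκ₁ : κ < 1 := Real.rpow_lt_one hη₀.le hη₁ (by linarith)
  set B := 2 * (4 * C₀ + 4) * (1 + (η ^ 4)⁻¹ ^ 2) + 2 with hB
  have hB0 : 0 < B := by positivity
  have hη2 : η ^ 2 < 1 := pow_lt_one₀ hη₀.le hη₁ two_ne_zero
  set D := B * (1 - η ^ 2)⁻¹ + 4 * (1 - κ)⁻¹ with hD
  have hD0 : 0 < D := by
    have h₁ := inv_pos.2 (sub_pos.2 hη2)
    have h₂ := inv_pos.2 (sub_pos.2 hκ₁)
    positivity
  refine ⟨√(2 * D), by positivity, ?_⟩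
  intro V _ _ G _ _ hG N hN hNV hK ψ lam hψ0 hψ hlam
  obtain ⟨x₀, -⟩ := Function.ne_iff.1 hψ0
  have hcard : 0 < Fintype.card V := Fintype.card_pos_iff.2 ⟨x₀⟩
  have hN0 : (0 : ℝ) < N := mod_cast hN
  obtain ⟨v, μ, hv, hμ⟩ := exists_orthonormal_eigenbasis_Tq q G
  have hK' (n : ℕ) (h₁ : 1 ≤ n) (h₂ : n ≤ N) (x y : V) :
      |Kker q G n x y| ≤ C₀ * (η ^ 4) ^ n := by
    refine (hK n h₁ h₂ x y).trans ?_
    rw [hη4, ← Real.rpow_natCast, ← Real.rpow_mul (by linarith), neg_mul]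
    have hle : γ * n ≤ β * n := mul_le_mul_of_nonneg_right (min_le_left _ _) n.cast_nonneg
    have hexp := Real.rpow_le_rpow_of_exponent_le hq1.le (neg_le_neg hle)
    exact mul_le_mul_of_nonneg_left hexp hC₀.le
  have hL0 : 0 ≤ lpN 2 ψ := by unfold lpN; positivity
  refine lpN_le_of_forall_sum_mul_le (by linarith) (by positivity) fun f hf => ?_
  refine le_of_sq_le_sq ?_ (by positivity)
  have hproj := mul_sum_coeffs_sq_le (v := v) (μ := μ) (f := f) (N := N)
    (e := fun n => B * (η ^ 2) ^ n + 4 * κ ^ n) (fun n => by positivity)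
    (fun n hn => abs_quadForm_temperedWeight_le hq hG hC₀.le hη₀ hη₁.le hqη hNV hcard hK' hv hμ
      hr₁ hr₂ hf hn.le) (abs_le.2 hlam)
  have hsum : ∑ n ∈ range N, (B * (η ^ 2) ^ n + 4 * κ ^ n) ≤ D := by
    rw [sum_add_distrib, ← mul_sum, ← mul_sum, hD]
    gcongr
    · exact sum_range_pow_le (by positivity) hη2 N
    · exact sum_range_pow_le (by positivity) hκ₁ N
  have hA : ∑ i with μ i = lam, coeffs v f i ^ 2 ≤ 2 * D / N := by
    rw [le_div_iff₀ hN0]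
    refine le_of_mul_le_mul_left ?_ hN0
    calc _ = (N : ℝ) ^ 2 * ∑ i with μ i = lam, coeffs v f i ^ 2 := by ring
      _ ≤ 2 * N * D := hproj.trans (by gcongr)
      _ = _ := by ring
  calc _ ≤ (∑ i with μ i = lam, coeffs v f i ^ 2) * ∑ x, ψ x ^ 2 :=
        sq_sum_mul_eigenfunction_le q G hv hμ hψ f
    _ ≤ 2 * D / N * lpN 2 ψ ^ 2 := by
        rw [lpN_two_sq]
        gcongr
    _ = _ := by
        rw [div_pow, mul_pow, Real.sq_sqrt (by positivity), Real.sq_sqrt hN0.le]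
        ring
end

section
/- Let q ≥ 2 be an integer, β > 0, C₀ > 0 and p > 2. There exists a constant C = C(q, β, C₀, p) > 0 such that the following holds. Let G be any finite (q+1)-regular Ramanujan graph with vertex set V, let N be an even integer with 2 ≤ N ≤ log_q |V| such that Condition (★★) holds with constants β, C₀ and the integer N, and for α ∈ [0, π] define the operator W_{N,α} = Σ_{n=1}^{N/2} cos(2nα) · P_{2n}(T_q/2) ∘ Π on functions V → ℝ. Then ‖W_{N,α} f‖_p ≤ C · √N · ‖f‖_2 for every function f : V → ℝ and every α ∈ [0, π]. -/
open Finset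

/-- The projection onto the orthogonal complement of the constants:
`Πf = f - (1/|V|) ∑_y f(y)`. -/
noncomputable def Pproj {V : Type*} [Fintype V] (f : V → ℝ) : V → ℝ :=
  fun x => f x - (∑ y, f y) / (Fintype.card V)

/-- The operator `P_m(T_q/2)`, where `P_m` is the degree-`m` Chebyshev polynomial of the first
kind (`P_m(cos θ) = cos(mθ)`), applied to the operator `T_q/2` via the Chebyshev recurrence
`P_0 = 1`, `P_1 = x`, `P_{m+2}(x) = 2x·P_{m+1}(x) - P_m(x)`. -/
noncomputable def chebOp {V : Type*} [Fintype V] (q : ℕ) (G : SimpleGraph V)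
    [DecidableRel G.Adj] : ℕ → (V → ℝ) → (V → ℝ)
  | 0 => fun f => f
  | 1 => fun f x => (1 / 2) * Tq q G f x
  | (m + 2) => fun f x => Tq q G (chebOp q G (m + 1) f) x - chebOp q G m f x

/-- The operator `W_{N,α} = ∑_{n=1}^{N/2} cos(2nα) · P_{2n}(T_q/2) ∘ Π`. -/
noncomputable def Wop {V : Type*} [Fintype V] (q : ℕ) (G : SimpleGraph V)
    [DecidableRel G.Adj] (N : ℕ) (α : ℝ) (f : V → ℝ) : V → ℝ :=
  fun x => ∑ n ∈ Finset.Icc 1 (N / 2), Real.cos (2 * n * α) * chebOp q G (2 * n) (Pproj f) x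

lemma sum_sq_le_one {V : Type*} [Fintype V] {r : ℝ} (hr : 0 < r) (hr2 : r ≤ 2)
    {h : V → ℝ} (hh : ∑ x, |h x| ^ r ≤ 1) : ∑ x, h x ^ 2 ≤ 1 := by
  refine le_trans (Finset.sum_le_sum fun x _ => ?_) hh
  have hx1 : |h x| ≤ 1 := by
    by_contra! hx
    have h1 : 1 < |h x| ^ r := Real.one_lt_rpow hx hr
    have h2 : |h x| ^ r ≤ ∑ x, |h x| ^ r :=
      Finset.single_le_sum (f := fun x => |h x| ^ r) (fun y _ => by positivity) (Finset.mem_univ x)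
    linarith
  rcases eq_or_lt_of_le (abs_nonneg (h x)) with h0 | h0
  · rw [abs_eq_zero.mp h0.symm, zero_pow two_ne_zero]
    positivity
  · rw [← sq_abs, ← Real.rpow_natCast]
    exact Real.rpow_le_rpow_of_exponent_ge h0 hx1 (by push_cast; linarith)

/-- A quadratic form that is bounded on `ℓ²` and decays exponentially on `ℓ¹` decays exponentially
on `ℓ^r` for `1 < r < 2`. -/
lemma interpolation_bound {ι V : Type*} [Fintype ι] [Fintype V]
    (c : ι → (V → ℝ) →ₗ[ℝ] ℝ) (hc : ∀ f, ∑ i, (c i f) ^ 2 = ∑ x, f x ^ 2)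
    (e : ι → ℝ) (he : ∀ i, |e i| ≤ 1) (A ρ : ℝ) (hA : 0 ≤ A) (hρ : 0 < ρ) (hρ1 : ρ < 1) (n : ℕ)
    (hk : ∀ h, |∑ i, e i * (c i h) ^ 2| ≤ A * ρ ^ n * (∑ x, |h x|) ^ 2)
    (r : ℝ) (hr1 : 1 < r) (hr2 : r < 2) (h : V → ℝ) (hh : ∑ x, |h x| ^ r ≤ 1) :
    |∑ i, e i * (c i h) ^ 2| ≤ (A + 3) * (ρ ^ ((2 - r) / 8)) ^ n := by
  classical
  have hn0 : (0 : ℝ) ≤ n := Nat.cast_nonneg n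
  set s : ℝ := ρ ^ ((n : ℝ) / 4) with hs
  have hs0 : 0 < s := Real.rpow_pos_of_pos hρ _
  set t : ℝ := (ρ ^ ((2 - r) / 8)) ^ n with ht
  have ht' : t = ρ ^ ((2 - r) / 8 * n) := by rw [ht, ← Real.rpow_natCast, ← Real.rpow_mul hρ.le]
  have ht0 : 0 < t := by positivity
  have ht1 : t ≤ 1 := by
    rw [ht']
    exact Real.rpow_le_one hρ.le hρ1.le (mul_nonneg (by linarith) hn0)
  have ht2 : s ^ (2 - r) = t ^ 2 := by
    rw [ht', hs, ← Real.rpow_mul hρ.le, ← Real.rpow_natCast, ← Real.rpow_mul hρ.le]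
    congr 1
    push_cast
    ring
  set u : V → ℝ := fun x => if s < |h x| then h x else 0 with hu
  set v : V → ℝ := fun x => if s < |h x| then 0 else h x with hv
  have huv : h = u + v := by
    funext x
    simp only [hu, hv, Pi.add_apply]
    split_ifs <;> simp
  have hu1 : ∑ x, |u x| ≤ s ^ (1 - r) := by
    calc ∑ x, |u x| ≤ ∑ x, s ^ (1 - r) * |h x| ^ r := by
          refine Finset.sum_le_sum fun x _ => ?_
          simp only [hu]
          split_ifs with hx
          · have h0 : 0 < |h x| := hs0.trans hx
            have h1 : |h x| ^ (1 - r) ≤ s ^ (1 - r) :=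
              Real.rpow_le_rpow_of_nonpos hs0 hx.le (by linarith)
            calc |h x| = |h x| ^ (1 - r) * |h x| ^ r := by
                  rw [← Real.rpow_add h0]; simp
              _ ≤ _ := by gcongr
          · rw [abs_zero]; positivity
      _ = s ^ (1 - r) * ∑ x, |h x| ^ r := by rw [Finset.mul_sum]
      _ ≤ s ^ (1 - r) * 1 := by gcongr
      _ = _ := mul_one _
  have hu2 : ∑ x, u x ^ 2 ≤ 1 := by
    refine le_trans (Finset.sum_le_sum fun x _ => ?_) (sum_sq_le_one (by linarith) hr2.le hh)
    simp only [hu]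
    split_ifs
    · exact le_rfl
    · rw [zero_pow two_ne_zero]; positivity
  have hv2 : ∑ x, v x ^ 2 ≤ t ^ 2 := by
    calc ∑ x, v x ^ 2 ≤ ∑ x, s ^ (2 - r) * |h x| ^ r := by
          refine Finset.sum_le_sum fun x _ => ?_
          simp only [hv]
          split_ifs with hx
          · rw [zero_pow two_ne_zero]; positivity
          · push Not at hx
            rcases eq_or_lt_of_le (abs_nonneg (h x)) with h0 | h0
            · rw [abs_eq_zero.mp h0.symm, zero_pow two_ne_zero]; positivity
            · calc h x ^ 2 = |h x| ^ (2 - r) * |h x| ^ r := by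
                    rw [← Real.rpow_add h0, ← sq_abs, ← Real.rpow_natCast]; simp
                _ ≤ _ := by
                    gcongr
      _ = s ^ (2 - r) * ∑ x, |h x| ^ r := by rw [Finset.mul_sum]
      _ ≤ s ^ (2 - r) * 1 := by gcongr
      _ = _ := by rw [mul_one, ht2]
  have hsplit : ∑ i, e i * (c i h) ^ 2 = ∑ i, e i * (c i u) ^ 2 +
      ∑ i, e i * (2 * (c i u * c i v) + (c i v) ^ 2) := by
    rw [← Finset.sum_add_distrib]
    refine Finset.sum_congr rfl fun i _ => ?_
    rw [huv, map_add]
    ring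
  have hrest : |∑ i, e i * (2 * (c i u * c i v) + (c i v) ^ 2)| ≤ 3 * t := by
    have h1 : ∀ i, |e i * (2 * (c i u * c i v) + (c i v) ^ 2)|
        ≤ t * (c i u) ^ 2 + (t⁻¹ + 1) * (c i v) ^ 2 := by
      intro i
      rw [abs_mul]
      have h2 : |2 * (c i u * c i v) + (c i v) ^ 2|
          ≤ t * (c i u) ^ 2 + (t⁻¹ + 1) * (c i v) ^ 2 := by
        have h3 : t * (c i u) ^ 2 + t⁻¹ * (c i v) ^ 2 - 2 * (c i u * c i v)
            = t * (c i u - t⁻¹ * c i v) ^ 2 := by field_simp; ring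
        have h4 : t * (c i u) ^ 2 + t⁻¹ * (c i v) ^ 2 + 2 * (c i u * c i v)
            = t * (c i u + t⁻¹ * c i v) ^ 2 := by field_simp; ring
        have h5 : 0 ≤ t * (c i u - t⁻¹ * c i v) ^ 2 := by positivity
        have h6 : 0 ≤ t * (c i u + t⁻¹ * c i v) ^ 2 := by positivity
        have h7 := sq_nonneg (c i v)
        rw [abs_le]
        constructor <;> linarith
      calc _ ≤ 1 * |2 * (c i u * c i v) + (c i v) ^ 2| := by
            gcongr
            exact he i
        _ ≤ _ := by rw [one_mul]; exact h2
    calc _ ≤ ∑ i, |e i * (2 * (c i u * c i v) + (c i v) ^ 2)| := Finset.abs_sum_le_sum_abs _ _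
      _ ≤ ∑ i, (t * (c i u) ^ 2 + (t⁻¹ + 1) * (c i v) ^ 2) := Finset.sum_le_sum fun i _ => h1 i
      _ = t * ∑ x, u x ^ 2 + (t⁻¹ + 1) * ∑ x, v x ^ 2 := by
          rw [Finset.sum_add_distrib, ← Finset.mul_sum, ← Finset.mul_sum, hc, hc]
      _ ≤ t * 1 + (t⁻¹ + 1) * t ^ 2 := by gcongr
      _ = 2 * t + t * t := by field_simp; ring
      _ ≤ 3 * t := by nlinarith
  have hmain : |∑ i, e i * (c i u) ^ 2| ≤ A * t := by
    calc _ ≤ A * ρ ^ n * (∑ x, |u x|) ^ 2 := hk u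
      _ ≤ A * ρ ^ n * (s ^ (1 - r)) ^ 2 := by gcongr
      _ = A * ρ ^ ((n : ℝ) + (n : ℝ) / 4 * (1 - r) * 2) := by
          rw [mul_assoc]
          congr 1
          rw [Real.rpow_add hρ, Real.rpow_natCast, hs, ← Real.rpow_mul hρ.le,
            ← Real.rpow_natCast _ 2, ← Real.rpow_mul hρ.le]
          norm_num
      _ ≤ A * t := by
          rw [ht']
          refine mul_le_mul_of_nonneg_left ?_ hA
          refine Real.rpow_le_rpow_of_exponent_ge hρ hρ1.le ?_
          nlinarith
  rw [hsplit]
  calc _ ≤ _ := abs_add_le _ _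
    _ ≤ A * t + 3 * t := add_le_add hmain hrest
    _ = _ := by ring

lemma sum_pow_dist_le (σ : ℝ) (hσ : 0 ≤ σ) (hσ1 : σ < 1) (j K : ℕ) :
    ∑ k ∈ Finset.range K, σ ^ ((j - k) + (k - j)) ≤ 2 / (1 - σ) := by
  have hgeom : ∀ n : ℕ, ∑ k ∈ Finset.range n, σ ^ k ≤ 1 / (1 - σ) := by
    intro n
    rw [one_div, ← tsum_geometric_of_lt_one hσ hσ1]
    exact (summable_geometric_of_lt_one hσ hσ1).sum_le_tsum _ fun i _ => by positivity
  calc _ ≤ ∑ k ∈ Finset.range (j + 1 + K), σ ^ ((j - k) + (k - j)) := by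
        refine Finset.sum_le_sum_of_subset_of_nonneg ?_ fun i _ _ => by positivity
        exact Finset.range_subset_range.mpr (by omega)
    _ = ∑ k ∈ Finset.range (j + 1), σ ^ (j + 1 - 1 - k) + ∑ k ∈ Finset.range K, σ ^ (k + 1) := by
        rw [Finset.sum_range_add]
        congr 1
        · refine Finset.sum_congr rfl fun k hk => ?_
          rw [Finset.mem_range] at hk
          congr 1
          omega
        · refine Finset.sum_congr rfl fun k hk => ?_
          congr 1
          omega
    _ ≤ 1 / (1 - σ) + 1 / (1 - σ) := by
        rw [Finset.sum_range_reflect (fun k => σ ^ k)]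
        refine add_le_add (hgeom _) (le_trans (Finset.sum_le_sum fun k _ => ?_) (hgeom K))
        exact pow_le_pow_of_le_one hσ hσ1.le (Nat.le_succ k)
    _ = _ := by ring

lemma block_bound {ι : Type*} [Fintype ι] (w : ι → ℝ) (e : ι → ℕ → ℝ)
    (hmul : ∀ i m n, m ≤ n → 2 * (e i m * e i n) = e i (m + n) + e i (n - m))
    (D σ : ℝ) (hD : 0 ≤ D) (hσ : 0 ≤ σ) (hσ1 : σ < 1) (M : ℕ)
    (hdecay : ∀ n ≤ M, |∑ i, e i n * w i ^ 2| ≤ D * σ ^ n)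
    (K : ℕ) (hK : 2 * K ≤ M + 2) (a : ℕ → ℝ) (ha : ∀ n, |a n| ≤ 1) :
    ∑ i, (∑ j ∈ Finset.range K, a j * e i j) ^ 2 * w i ^ 2 ≤ D * (2 / (1 - σ)) * K := by
  have hle : ∀ j k, j < K → k < K → j ≤ k →
      |∑ i, e i j * e i k * w i ^ 2| ≤ D * σ ^ ((j - k) + (k - j)) := by
    intro j k hj hk hjk
    have h1 : ∑ i, e i j * e i k * w i ^ 2
        = (∑ i, e i (j + k) * w i ^ 2 + ∑ i, e i (k - j) * w i ^ 2) / 2 := by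
      rw [← Finset.sum_add_distrib, Finset.sum_div]
      refine Finset.sum_congr rfl fun i _ => ?_
      linear_combination (w i ^ 2 / 2) * hmul i j k hjk
    have h2 := hdecay (j + k) (by omega)
    have h3 := hdecay (k - j) (by omega)
    have h4 : D * σ ^ (j + k) ≤ D * σ ^ (k - j) :=
      mul_le_mul_of_nonneg_left (pow_le_pow_of_le_one hσ hσ1.le (by omega)) hD
    have h5 := abs_add_le (∑ i, e i (j + k) * w i ^ 2) (∑ i, e i (k - j) * w i ^ 2)
    have h6 : (j - k) + (k - j) = k - j := by omega
    rw [h1, abs_div, abs_two, h6]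
    linarith
  have hle' : ∀ j k, j < K → k < K →
      |∑ i, e i j * e i k * w i ^ 2| ≤ D * σ ^ ((j - k) + (k - j)) := by
    intro j k hj hk
    rcases le_total j k with h | h
    · exact hle j k hj hk h
    · have := hle k j hk hj h
      rw [add_comm]
      simpa only [mul_comm (e _ j)] using this
  have hexp : ∑ i, (∑ j ∈ Finset.range K, a j * e i j) ^ 2 * w i ^ 2
      = ∑ j ∈ Finset.range K, ∑ k ∈ Finset.range K,
          a j * a k * ∑ i, e i j * e i k * w i ^ 2 := by
    simp_rw [sq (∑ j ∈ Finset.range K, _), Finset.sum_mul_sum, Finset.sum_mul, Finset.mul_sum]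
    rw [Finset.sum_comm]
    refine Finset.sum_congr rfl fun j _ => ?_
    rw [Finset.sum_comm]
    refine Finset.sum_congr rfl fun k _ => Finset.sum_congr rfl fun i _ => ?_
    ring
  rw [hexp]
  calc _ ≤ ∑ j ∈ Finset.range K, ∑ k ∈ Finset.range K, D * σ ^ ((j - k) + (k - j)) := by
        refine Finset.sum_le_sum fun j hj => Finset.sum_le_sum fun k hk => ?_
        rw [Finset.mem_range] at hj hk
        refine (le_abs_self _).trans ?_
        rw [abs_mul, abs_mul]
        calc _ ≤ 1 * 1 * |∑ i, e i j * e i k * w i ^ 2| := by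
              gcongr
              · exact ha j
              · exact ha k
          _ ≤ _ := by rw [one_mul, one_mul]; exact hle' j k hj hk
    _ ≤ ∑ j ∈ Finset.range K, D * (2 / (1 - σ)) := by
        refine Finset.sum_le_sum fun j _ => ?_
        rw [← Finset.mul_sum]
        exact mul_le_mul_of_nonneg_left (sum_pow_dist_le σ hσ hσ1 j K) hD
    _ = _ := by rw [Finset.sum_const, Finset.card_range, nsmul_eq_mul, mul_comm]

lemma sum_eq_blocks (e a : ℕ → ℝ)
    (hmul : ∀ m n, m ≤ n → 2 * (e m * e n) = e (m + n) + e (n - m)) (L : ℕ) :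
    ∑ n ∈ Finset.range (L + 1 + L + 1), a n * e n =
      ∑ n ∈ Finset.range (L + 1), a n * e n
      + 2 * e L * ∑ n ∈ Finset.range (L + 1), (if n = 0 then 0 else a (L + n)) * e n
      - ∑ n ∈ Finset.range L, a (2 * L - n) * e n
      + a (2 * L + 1) * e (2 * L + 1) := by
  rw [Finset.sum_range_succ, Finset.sum_range_add,
    Finset.sum_range_succ' (fun n => (if n = 0 then 0 else a (L + n)) * e n),
    ← Finset.sum_range_reflect (fun n => a (2 * L - n) * e n)]
  have h1 : ∑ x ∈ Finset.range L, a (L + 1 + x) * e (L + 1 + x)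
      = 2 * e L * ∑ x ∈ Finset.range L, a (L + (x + 1)) * e (x + 1)
        - ∑ x ∈ Finset.range L, a (2 * L - (L - 1 - x)) * e (L - 1 - x) := by
    rw [Finset.mul_sum, ← Finset.sum_sub_distrib]
    refine Finset.sum_congr rfl fun x hx => ?_
    rw [Finset.mem_range] at hx
    have h2 := hmul (x + 1) L hx
    rw [show 2 * L - (L - 1 - x) = L + 1 + x by omega, show L + (x + 1) = L + 1 + x by omega]
    rw [show x + 1 + L = L + 1 + x by omega, show L - (x + 1) = L - 1 - x by omega] at h2
    linear_combination (-a (L + 1 + x)) * h2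
  rw [h1, show L + 1 + L = 2 * L + 1 by omega]
  simp only [Nat.add_eq_zero_iff, one_ne_zero, and_false, if_false, if_true, zero_mul, add_zero]
  ring

lemma multiplier_bound {ι : Type*} [Fintype ι] (w : ι → ℝ) (hw : ∑ i, w i ^ 2 ≤ 1)
    (e : ι → ℕ → ℝ) (he : ∀ i n, |e i n| ≤ 1)
    (hmul : ∀ i m n, m ≤ n → 2 * (e i m * e i n) = e i (m + n) + e i (n - m))
    (D σ : ℝ) (hD : 0 ≤ D) (hσ : 0 ≤ σ) (hσ1 : σ < 1) (M : ℕ) (hM : 1 ≤ M)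
    (hdecay : ∀ n ≤ M, |∑ i, e i n * w i ^ 2| ≤ D * σ ^ n)
    (a : ℕ → ℝ) (ha : ∀ n, |a n| ≤ 1) :
    ∑ i, (∑ n ∈ Finset.Icc 1 M, a n * e i n) ^ 2 * w i ^ 2
      ≤ (24 * (D * (2 / (1 - σ))) + 4) * (2 * M) := by
  set L := M / 2 with hL
  set b : ℕ → ℝ := fun n => if n ∈ Finset.Icc 1 M then a n else 0 with hb
  have hb1 : ∀ n, |b n| ≤ 1 := by
    intro n
    simp only [hb]
    split_ifs
    · exact ha n
    · simp
  set E := D * (2 / (1 - σ)) with hE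
  have hE0 : 0 ≤ E := mul_nonneg hD (div_nonneg two_pos.le (by linarith))
  have hsum : ∀ i, ∑ n ∈ Finset.Icc 1 M, a n * e i n
      = ∑ n ∈ Finset.range (L + 1 + L + 1), b n * e i n := by
    intro i
    have hsub : Finset.Icc 1 M ⊆ Finset.range (L + 1 + L + 1) := by
      intro n hn
      rw [Finset.mem_Icc] at hn
      rw [Finset.mem_range]
      omega
    rw [← Finset.sum_subset hsub]
    · refine Finset.sum_congr rfl fun n hn => ?_
      simp only [hb, if_pos hn]
    · intro n _ hn
      simp only [hb, if_neg hn, zero_mul]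
  have hX := block_bound w e hmul D σ hD hσ hσ1 M hdecay (L + 1) (by omega) b hb1
  have hY := block_bound w e hmul D σ hD hσ hσ1 M hdecay (L + 1) (by omega)
    (fun n => if n = 0 then 0 else b (L + n)) (by
      intro n
      split_ifs
      · simp
      · exact hb1 _)
  have hZ := block_bound w e hmul D σ hD hσ hσ1 M hdecay L (by omega)
    (fun n => b (2 * L - n)) (fun n => hb1 _)
  rw [← hE] at hX hY hZ
  have hpt : ∀ i, (∑ n ∈ Finset.Icc 1 M, a n * e i n) ^ 2 * w i ^ 2 ≤
      4 * ((∑ n ∈ Finset.range (L + 1), b n * e i n) ^ 2 * w i ^ 2)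
      + 16 * ((∑ n ∈ Finset.range (L + 1), (if n = 0 then 0 else b (L + n)) * e i n) ^ 2 * w i ^ 2)
      + 4 * ((∑ n ∈ Finset.range L, b (2 * L - n) * e i n) ^ 2 * w i ^ 2)
      + 4 * w i ^ 2 := by
    intro i
    rw [hsum i, sum_eq_blocks (e i) b (hmul i) L]
    generalize ∑ n ∈ Finset.range (L + 1), b n * e i n = X
    generalize ∑ n ∈ Finset.range (L + 1), (if n = 0 then 0 else b (L + n)) * e i n = Y
    generalize ∑ n ∈ Finset.range L, b (2 * L - n) * e i n = Z
    have h1 : (b (2 * L + 1) * e i (2 * L + 1)) ^ 2 ≤ 1 := by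
      rw [sq_le_one_iff_abs_le_one, abs_mul]
      exact mul_le_one₀ (hb1 _) (abs_nonneg _) (he _ _)
    have h2 : (2 * e i L * Y) ^ 2 ≤ 4 * Y ^ 2 := by
      have : e i L ^ 2 ≤ 1 := by
        rw [sq_le_one_iff_abs_le_one]; exact he _ _
      nlinarith [sq_nonneg Y]
    generalize b (2 * L + 1) * e i (2 * L + 1) = W at h1
    generalize 2 * e i L * Y = Y' at h2
    have h3 : (X + Y' - Z + W) ^ 2 ≤ 4 * X ^ 2 + 16 * Y ^ 2 + 4 * Z ^ 2 + 4 := by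
      nlinarith [sq_nonneg (X - Y'), sq_nonneg (X + Z), sq_nonneg (X - W), sq_nonneg (Y' + Z),
        sq_nonneg (Y' - W), sq_nonneg (Z + W)]
    nlinarith [mul_le_mul_of_nonneg_right h3 (sq_nonneg (w i))]
  have hLM : (L : ℝ) + 1 ≤ 2 * M := by
    have : L + 1 ≤ 2 * M := by omega
    exact_mod_cast this
  have hM' : (1 : ℝ) ≤ M := by exact_mod_cast hM
  calc _ ≤ _ := Finset.sum_le_sum fun i _ => hpt i
    _ ≤ 4 * (E * (L + 1)) + 16 * (E * (L + 1)) + 4 * (E * (L + 1)) + 4 := by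
        rw [Finset.sum_add_distrib, Finset.sum_add_distrib, Finset.sum_add_distrib,
          ← Finset.mul_sum, ← Finset.mul_sum, ← Finset.mul_sum, ← Finset.mul_sum]
        push_cast at hX hY hZ
        nlinarith
    _ ≤ _ := by nlinarith [mul_le_mul_of_nonneg_left hLM hE0]

section Graph

variable {V : Type*} [Fintype V] (q : ℕ) (G : SimpleGraph V) [DecidableRel G.Adj]

lemma Tq_sum_mul {ι : Type*} (s : Finset ι) (F : ι → V → ℝ) (a : ι → ℝ) :
    Tq q G (fun z => ∑ i ∈ s, F i z * a i) = fun x => ∑ i ∈ s, Tq q G (F i) x * a i := by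
  funext x
  simp only [Tq]
  rw [Finset.sum_comm, Finset.mul_sum]
  refine Finset.sum_congr rfl fun i _ => ?_
  rw [← Finset.sum_mul, mul_assoc]

lemma Tq_add_mul (f g : V → ℝ) (a : ℝ) :
    Tq q G (fun z => f z + a * g z) = fun x => Tq q G f x + a * Tq q G g x := by
  funext x
  simp only [Tq, Finset.sum_add_distrib, ← Finset.mul_sum]
  ring

lemma Tq_sub_mul (f g : V → ℝ) (a : ℝ) :
    Tq q G (fun z => f z - a * g z) = fun x => Tq q G f x - a * Tq q G g x := by
  simpa [sub_eq_add_neg] using Tq_add_mul q G f g (-a)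

lemma Tq_const {q : ℕ} {G : SimpleGraph V} [DecidableRel G.Adj]
    (hG : G.IsRegularOfDegree (q + 1)) (a : ℝ) :
    Tq q G (fun _ => a) = fun _ => ((q : ℝ) + 1) / Real.sqrt q * a := by
  funext x
  simp only [Tq, Finset.sum_const, SimpleGraph.card_neighborFinset_eq_degree, hG.degree_eq x,
    nsmul_eq_mul]
  push_cast
  ring

lemma sum_mul_Tq [DecidableEq V] (f g : V → ℝ) : ∑ x, g x * Tq q G f x = ∑ x, Tq q G g x * f x := by
  simp only [Tq, SimpleGraph.neighborFinset_eq_filter, Finset.sum_filter, Finset.mul_sum,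
    Finset.sum_mul]
  rw [Finset.sum_comm]
  refine Finset.sum_congr rfl fun x _ => Finset.sum_congr rfl fun y _ => ?_
  simp only [G.adj_comm x y]
  split_ifs <;> ring

lemma Sop_eq_sum [DecidableEq V] (f : V → ℝ) (n : ℕ) :
    Sop q G n f = fun x => ∑ y, Kker q G n x y * f y := by
  have h0 : f = fun x => ∑ y, (if x = y then (1 : ℝ) else 0) * f y := by
    funext x
    simp
  have h1 : Tq q G f = fun x => ∑ y, Tq q G (fun z => if z = y then (1 : ℝ) else 0) x * f y := by
    conv_lhs => rw [h0]
    exact Tq_sum_mul q G _ _ _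
  have h2 : Tq q G (Tq q G f)
      = fun x => ∑ y, Tq q G (Tq q G (fun z => if z = y then (1 : ℝ) else 0)) x * f y := by
    rw [h1]
    exact Tq_sum_mul q G _ _ _
  induction n using Sop.induct with
  | case1 => exact h0
  | case2 => exact h1
  | case3 =>
    funext x
    simp only [Sop, Kker, h2, sub_mul, Finset.sum_sub_distrib]
    congr 1
    conv_lhs => rw [h0]
    simp only [Finset.mul_sum, mul_assoc]
  | case4 n ih2 ih1 =>
    funext x
    simp only [Sop, Kker, sub_mul, Finset.sum_sub_distrib] at ih1 ih2 ⊢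
    rw [ih1, ih2, Tq_sum_mul]

lemma two_mul_chebOp_add_three (f : V → ℝ) (n : ℕ) :
    ∀ x, 2 * chebOp q G (n + 3) f x
      = (q : ℝ)⁻¹ * (2 * chebOp q G (n + 1) f x) + Sop q G (n + 3) f x - Sop q G (n + 1) f x := by
  have hT : ∀ g : V → ℝ, Tq q G (fun x => 1 / 2 * g x) = fun x => 1 / 2 * Tq q G g x := by
    intro g
    simpa [Tq] using Tq_add_mul q G (fun _ => 0) g (1 / 2)
  have hTs : ∀ g h : V → ℝ, ∀ a : ℝ, Tq q G (fun x => g x - a * h x)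
      = fun x => Tq q G g x - a * Tq q G h x := Tq_sub_mul q G
  have hTs1 : ∀ g h : V → ℝ, Tq q G (fun x => g x - h x)
      = fun x => Tq q G g x - Tq q G h x := by
    intro g h
    simpa using Tq_sub_mul q G g h 1
  induction n using Nat.twoStepInduction with
  | zero =>
    intro x
    simp only [chebOp, Sop, hT, hTs, hTs1]
    ring
  | one =>
    intro x
    simp only [chebOp, Sop, hT, hTs, hTs1]
    ring
  | more n ih1 ih2 =>
    intro x
    have h2 : chebOp q G (n + 4) f = fun x => (1 / 2) * Sop q G (n + 4) f x
        + (1 / 2) * (q : ℝ)⁻¹ * (2 * chebOp q G (n + 2) f x) - 1 / 2 * Sop q G (n + 2) f x := by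
      funext x
      linarith [ih2 x]
    have h3 : Tq q G (chebOp q G (n + 4) f) x = (1 / 2) * Tq q G (Sop q G (n + 4) f) x
        + (q : ℝ)⁻¹ * Tq q G (chebOp q G (n + 2) f) x - 1 / 2 * Tq q G (Sop q G (n + 2) f) x := by
      rw [h2]
      simp only [Tq, Finset.sum_add_distrib, Finset.sum_sub_distrib, ← Finset.mul_sum]
      ring
    have e1 : chebOp q G (n + 2 + 3) f x
        = Tq q G (chebOp q G (n + 4) f) x - chebOp q G (n + 3) f x := rfl
    have e2 : chebOp q G (n + 2 + 1) f x
        = Tq q G (chebOp q G (n + 2) f) x - chebOp q G (n + 1) f x := rfl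
    have e3 : Sop q G (n + 2 + 3) f x
        = Tq q G (Sop q G (n + 4) f) x - Sop q G (n + 3) f x := rfl
    have e4 : Sop q G (n + 2 + 1) f x
        = Tq q G (Sop q G (n + 2) f) x - Sop q G (n + 1) f x := rfl
    have := ih1 x
    rw [e1, e3, e4, h3]
    rw [show chebOp q G (n + 2 + 1) f x = _ from e2]
    linarith

lemma chebOp_sub_mul (f g : V → ℝ) (a : ℝ) (n : ℕ) :
    chebOp q G n (fun z => f z - a * g z)
      = fun x => chebOp q G n f x - a * chebOp q G n g x := by
  induction n using chebOp.induct with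
  | case1 => rfl
  | case2 =>
    funext x
    simp only [chebOp, Tq_sub_mul]
    ring
  | case3 n ih1 ih2 =>
    funext x
    simp only [chebOp, ih1, ih2, Tq_sub_mul]
    ring

lemma chebOp_one {q : ℕ} {G : SimpleGraph V} [DecidableRel G.Adj] (hq : 2 ≤ q)
    (hG : G.IsRegularOfDegree (q + 1)) (n : ℕ) :
    chebOp q G n (fun _ => 1) = fun _ => (Real.sqrt q ^ n + (Real.sqrt q)⁻¹ ^ n) / 2 := by
  have hq0 : (0 : ℝ) < q := by exact_mod_cast (by omega : 0 < q)
  have hs : Real.sqrt q ≠ 0 := (Real.sqrt_pos.mpr hq0).ne'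
  have hlam : ((q : ℝ) + 1) / Real.sqrt q = Real.sqrt q + (Real.sqrt q)⁻¹ := by
    field_simp
    rw [Real.sq_sqrt hq0.le]
  induction n using chebOp.induct with
  | case1 => simp [chebOp]
  | case2 =>
    funext x
    simp only [chebOp, Tq_const hG, hlam]
    ring
  | case3 n ih1 ih2 =>
    funext x
    simp only [chebOp, ih1, ih2, Tq_const hG, hlam]
    have := mul_inv_cancel₀ hs
    generalize Real.sqrt q = s at *
    generalize s⁻¹ = t at *
    simp only [Nat.succ_eq_add_one]
    linear_combination (s ^ n + t ^ n) / 2 * this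

lemma abs_chebOp_le [DecidableEq V] {q : ℕ} {G : SimpleGraph V} [DecidableRel G.Adj]
    (hq : 2 ≤ q) {β C₀ : ℝ} {N : ℕ}
    (hK : CondStarStar q G β C₀ N) {B ρ : ℝ} (hB : 1 ≤ B) (hBC : C₀ ≤ B)
    (hρ : (q : ℝ) ^ (-(2 * β)) ≤ ρ) (hρ4 : 3 / 4 ≤ ρ) (f : V → ℝ) (k : ℕ)
    (hk : 2 * k ≤ N) (x : V) :
    |chebOp q G (2 * k) f x| ≤ 4 * B * ρ ^ k * ∑ y, |f y| := by
  have hq2 : (2 : ℝ) ≤ q := by exact_mod_cast hq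
  have hq0 : (0 : ℝ) < q := by linarith
  set F := ∑ y, |f y| with hF
  have hF0 : 0 ≤ F := Finset.sum_nonneg fun y _ => abs_nonneg _
  have hfx : |f x| ≤ F :=
    Finset.single_le_sum (f := fun y => |f y|) (fun y _ => abs_nonneg _) (Finset.mem_univ x)
  have hS : ∀ k, 2 * k ≤ N → |Sop q G (2 * k) f x| ≤ B * ρ ^ k * F := by
    intro k hk
    rcases Nat.eq_zero_or_pos k with rfl | hk0
    · simp only [Sop, pow_zero, mul_one]
      nlinarith
    · rw [Sop_eq_sum]
      refine (Finset.abs_sum_le_sum_abs _ _).trans ?_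
      rw [hF, Finset.mul_sum]
      refine Finset.sum_le_sum fun y _ => ?_
      rw [abs_mul]
      refine mul_le_mul_of_nonneg_right ?_ (abs_nonneg _)
      refine (hK (2 * k) (by omega) hk x y).trans ?_
      have h1 : (q : ℝ) ^ (-(β * ((2 * k : ℕ) : ℝ))) = ((q : ℝ) ^ (-(2 * β))) ^ k := by
        rw [← Real.rpow_natCast, ← Real.rpow_mul hq0.le]
        congr 1
        push_cast
        ring
      rw [h1]
      gcongr
  have hqi : (q : ℝ)⁻¹ ≤ 1 / 2 := by
    rw [inv_le_comm₀ hq0 (by norm_num)]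
    linarith
  have hqi0 : 0 < (q : ℝ)⁻¹ := inv_pos.mpr hq0
  have key : ∀ k, 2 * (k + 1) ≤ N → |2 * chebOp q G (2 * (k + 1)) f x| ≤ 7 * B * ρ ^ (k + 1) * F := by
    intro k
    induction k with
    | zero =>
      intro hk
      have h1 : 2 * chebOp q G (2 * (0 + 1)) f x
          = Sop q G (2 * 1) f x - (1 - (q : ℝ)⁻¹) * f x := by
        have hT := congrFun (Tq_add_mul q G (fun _ => 0) (Tq q G f) (1 / 2)) x
        simp only [chebOp, Sop, zero_add] at hT ⊢
        rw [hT]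
        simp only [Tq, Finset.sum_const_zero]
        ring
      have h2 := hS 1 hk
      have h3 : |(1 - (q : ℝ)⁻¹) * f x| ≤ F := by
        rw [abs_mul, abs_of_nonneg (by linarith)]
        nlinarith [abs_nonneg (f x)]
      rw [h1]
      have h4 := abs_sub (Sop q G (2 * 1) f x) ((1 - (q : ℝ)⁻¹) * f x)
      have h5 : 0 ≤ B * F := by positivity
      rw [zero_add, pow_one] at *
      nlinarith [mul_le_mul_of_nonneg_left hρ4 h5, mul_le_mul_of_nonneg_right hB hF0]
    | succ k ih =>
      intro hk
      have h1 := two_mul_chebOp_add_three q G f (2 * k + 1) x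
      have h2 := ih (by omega)
      have h3 := hS (k + 1) (by omega)
      have h4 := hS (k + 2) (by omega)
      rw [show 2 * (k + 1 + 1) = 2 * k + 1 + 3 by ring, h1,
        show 2 * k + 1 + 1 = 2 * (k + 1) by ring, show 2 * k + 1 + 3 = 2 * (k + 2) by ring]
      have h5 : |(q : ℝ)⁻¹ * (2 * chebOp q G (2 * (k + 1)) f x)|
          ≤ 1 / 2 * (7 * B * ρ ^ (k + 1) * F) := by
        rw [abs_mul, abs_of_pos hqi0]
        gcongr
      have h6 := abs_sub ((q : ℝ)⁻¹ * (2 * chebOp q G (2 * (k + 1)) f x)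
        + Sop q G (2 * (k + 2)) f x) (Sop q G (2 * (k + 1)) f x)
      have h7 := abs_add_le ((q : ℝ)⁻¹ * (2 * chebOp q G (2 * (k + 1)) f x))
        (Sop q G (2 * (k + 2)) f x)
      have h8 : 0 ≤ B * ρ ^ (k + 1) * F := by positivity
      have h9 : B * ρ ^ (k + 2) * F = ρ * (B * ρ ^ (k + 1) * F) := by ring
      have h10 : 7 * B * ρ ^ (k + 1 + 1) * F = 7 * ρ * (B * ρ ^ (k + 1) * F) := by ring
      rw [h10]
      nlinarith [mul_le_mul_of_nonneg_right hρ4 h8]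
  rcases k with _ | k
  · simp only [chebOp, pow_zero, mul_one]
    nlinarith
  · have := key k hk
    rw [abs_mul, abs_two] at this
    have h8 : 0 ≤ B * ρ ^ (k + 1) * F := by positivity
    linarith

lemma abs_chebOp_Pproj_le [DecidableEq V] {q : ℕ} {G : SimpleGraph V} [DecidableRel G.Adj]
    (hq : 2 ≤ q) (hG : G.IsRegularOfDegree (q + 1)) {β C₀ : ℝ} {N : ℕ}
    (hN : (q : ℝ) ^ N ≤ Fintype.card V)
    (hK : CondStarStar q G β C₀ N) {B ρ : ℝ} (hB : 1 ≤ B) (hBC : C₀ ≤ B)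
    (hρ : (q : ℝ) ^ (-(2 * β)) ≤ ρ) (hρ4 : 3 / 4 ≤ ρ) (f : V → ℝ) (k : ℕ)
    (hk : 2 * k ≤ N) (x : V) :
    |chebOp q G (2 * k) (Pproj f) x| ≤ 5 * B * ρ ^ k * ∑ y, |f y| := by
  have hq2 : (2 : ℝ) ≤ q := by exact_mod_cast hq
  have hq0 : (0 : ℝ) < q := by linarith
  have hcard : (0 : ℝ) < Fintype.card V := lt_of_lt_of_le (by positivity) hN
  have hP : Pproj f = fun z => f z - ((∑ y, f y) / Fintype.card V) * (1 : ℝ) := by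
    funext z
    simp [Pproj]
  have h1 := abs_chebOp_le hq hK hB hBC hρ hρ4 f k hk x
  have hsum : |∑ y, f y| ≤ ∑ y, |f y| := Finset.abs_sum_le_sum_abs _ _
  have hval : (Real.sqrt q ^ (2 * k) + (Real.sqrt q)⁻¹ ^ (2 * k)) / 2 ≤ (q : ℝ) ^ k := by
    rw [pow_mul, pow_mul, inv_pow, Real.sq_sqrt hq0.le]
    have h2 : (1 : ℝ) ≤ (q : ℝ) ^ k := one_le_pow₀ (by linarith)
    have h3 : (q : ℝ)⁻¹ ^ k ≤ 1 := pow_le_one₀ (by positivity) (inv_le_one_of_one_le₀ (by linarith))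
    linarith
  have hval0 : 0 ≤ (Real.sqrt q ^ (2 * k) + (Real.sqrt q)⁻¹ ^ (2 * k)) / 2 :=
    div_nonneg (add_nonneg (pow_nonneg (Real.sqrt_nonneg _) _)
      (pow_nonneg (inv_nonneg.mpr (Real.sqrt_nonneg _)) _)) two_pos.le
  have hdiv : (q : ℝ) ^ k / Fintype.card V ≤ ρ ^ k := by
    rw [div_le_iff₀ hcard]
    have h2 : (q : ℝ) ^ k * (q : ℝ) ^ k ≤ Fintype.card V := by
      rw [← pow_add]
      exact (pow_le_pow_right₀ (by linarith) (by omega)).trans hN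
    have h3 : 1 ≤ ρ ^ k * (q : ℝ) ^ k := by
      rw [← mul_pow]
      exact one_le_pow₀ (by nlinarith)
    have h4 : (0 : ℝ) < (q : ℝ) ^ k := by positivity
    have h5 : 0 < ρ ^ k := pow_pos (by linarith) k
    nlinarith [mul_le_mul_of_nonneg_left h2 h5.le]
  rw [hP, chebOp_sub_mul, chebOp_one hq hG]
  refine (abs_sub _ _).trans ?_
  have h6 : |(∑ y, f y) / Fintype.card V
      * ((Real.sqrt q ^ (2 * k) + (Real.sqrt q)⁻¹ ^ (2 * k)) / 2)| ≤ ρ ^ k * ∑ y, |f y| := by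
    rw [abs_mul, abs_div, abs_of_pos hcard, abs_of_nonneg hval0]
    calc _ ≤ (∑ y, |f y|) / Fintype.card V * (q : ℝ) ^ k :=
          mul_le_mul (div_le_div_of_nonneg_right hsum hcard.le) hval hval0 (by positivity)
      _ = (q : ℝ) ^ k / Fintype.card V * ∑ y, |f y| := by ring
      _ ≤ _ := by gcongr
  have h7 : 0 ≤ ρ ^ k * ∑ y, |f y| := by
    have : 0 ≤ ρ := by linarith
    positivity
  nlinarith [mul_le_mul_of_nonneg_right hB h7]

lemma exists_spectral_coordinates [DecidableEq V] {q : ℕ} {G : SimpleGraph V} [DecidableRel G.Adj]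
    (hG : G.IsRegularOfDegree (q + 1)) (hR : IsRamanujan q G) :
    ∃ (c : V → (V → ℝ) →ₗ[ℝ] ℝ) (e : V → ℕ → ℝ),
      (∀ f g : V → ℝ, ∑ i, c i f * c i g = ∑ x, f x * g x) ∧
      (∀ i n f, c i (chebOp q G (2 * n) (Pproj f)) = e i n * c i f) ∧
      (∀ i n, |e i n| ≤ 1) ∧
      ∀ i m n, m ≤ n → 2 * (e i m * e i n) = e i (m + n) + e i (n - m) := by
  set A : Matrix V V ℝ := (Real.sqrt q)⁻¹ • G.adjMatrix ℝ with hA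
  have hAT : ∀ f, A.mulVec f = Tq q G f := by
    intro f
    funext x
    simp [hA, Matrix.smul_mulVec, Tq, SimpleGraph.adjMatrix_mulVec_apply]
  have hH : A.IsHermitian := by
    rw [Matrix.IsHermitian, hA, Matrix.conjTranspose_smul, star_trivial]
    congr 1
    ext i j
    simp [SimpleGraph.adjMatrix_apply, G.adj_comm]
  set b : V → V → ℝ := fun i => (hH.eigenvectorBasis i).ofLp with hb
  set lam := hH.eigenvalues with hlam
  have hTb : ∀ i, Tq q G (b i) = fun x => lam i * b i x := by
    intro i
    rw [← hAT, hb, hH.mulVec_eigenvectorBasis i]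
    rfl
  have hb0 : ∀ i, b i ≠ 0 := by
    intro i hi
    have h1 : hH.eigenvectorBasis i = 0 := by
      ext x
      exact congrFun hi x
    exact hH.eigenvectorBasis.orthonormal.ne_zero i h1
  let c : V → (V → ℝ) →ₗ[ℝ] ℝ := fun i =>
    { toFun := fun f => ∑ x, b i x * f x
      map_add' := fun f g => by simp [mul_add, Finset.sum_add_distrib]
      map_smul' := fun a f => by
        simp only [Pi.smul_apply, smul_eq_mul, RingHom.id_apply, Finset.mul_sum]
        exact Finset.sum_congr rfl fun x _ => by ring }
  have hc : ∀ i f, c i f = ∑ x, b i x * f x := fun i f => rfl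
  have hcT : ∀ i f, c i (Tq q G f) = lam i * c i f := by
    intro i f
    rw [hc, hc, sum_mul_Tq, hTb, Finset.mul_sum]
    exact Finset.sum_congr rfl fun x _ => by ring
  have hpars : ∀ f g : V → ℝ, ∑ i, c i f * c i g = ∑ x, f x * g x := by
    intro f g
    have := hH.eigenvectorBasis.sum_inner_mul_inner (WithLp.toLp 2 f) (WithLp.toLp 2 g)
    simp only [PiLp.inner_apply, RCLike.inner_apply, conj_trivial] at this
    rw [show ∑ x, f x * g x = ∑ x, g x * f x from Finset.sum_congr rfl fun x _ => mul_comm _ _,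
      ← this]
    refine Finset.sum_congr rfl fun i _ => ?_
    rw [hc, hc]
    congr 1
    exact Finset.sum_congr rfl fun x _ => mul_comm _ _
  have hP : ∀ f : V → ℝ, Pproj f = f - ((∑ y, f y) / Fintype.card V) • (fun _ => (1 : ℝ)) := by
    intro f
    funext z
    simp [Pproj]
  have hdich : ∀ i, ∃ e : ℕ → ℝ, (∀ n f, c i (chebOp q G (2 * n) (Pproj f)) = e n * c i f) ∧
      (∀ n, |e n| ≤ 1) ∧ ∀ m n, m ≤ n → 2 * (e m * e n) = e (m + n) + e (n - m) := by
    intro i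
    by_cases hi : lam i = ((q : ℝ) + 1) / Real.sqrt q
    · obtain ⟨a, ha⟩ := hR.2 (b i) (by rw [hTb, hi])
      have hPf : ∀ f, c i (Pproj f) = 0 := by
        intro f
        rw [hc, ha, ← Finset.mul_sum]
        have hne : (Fintype.card V : ℝ) ≠ 0 := by
          have : Nonempty V := ⟨i⟩
          exact_mod_cast Fintype.card_ne_zero
        simp only [Pproj, Finset.sum_sub_distrib, Finset.sum_const, Finset.card_univ, nsmul_eq_mul]
        rw [mul_div_cancel₀ _ hne, sub_self, mul_zero]
      have hcheb : ∀ n f, c i (chebOp q G n (Pproj f)) = 0 := by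
        intro n f
        induction n using chebOp.induct with
        | case1 => exact hPf f
        | case2 =>
          have : chebOp q G 1 (Pproj f) = (1 / 2 : ℝ) • Tq q G (Pproj f) := rfl
          rw [this, map_smul, hcT, hPf, mul_zero, smul_zero]
        | case3 n ih1 ih2 =>
          have : chebOp q G (n + 2) (Pproj f)
              = Tq q G (chebOp q G (n + 1) (Pproj f)) - chebOp q G n (Pproj f) := rfl
          rw [this, map_sub, hcT, ih1, ih2, mul_zero, sub_zero]
      exact ⟨fun _ => 0, fun n f => by rw [hcheb, zero_mul], by simp, by simp⟩
    · have hmem : lam i ∈ Set.Icc (-2 : ℝ) 2 := (hR.1 (b i) (lam i) (hb0 i) (hTb i)).resolve_right hi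
      set θ := Real.arccos (lam i / 2) with hθ
      have hcos : lam i = 2 * Real.cos θ := by
        rw [hθ, Real.cos_arccos (by linarith [hmem.1]) (by linarith [hmem.2])]
        ring
      have hc1 : c i (fun _ => (1 : ℝ)) = 0 := by
        have h1 := hcT i (fun _ => (1 : ℝ))
        rw [Tq_const hG] at h1
        have h2 : (fun _ : V => ((q : ℝ) + 1) / Real.sqrt q * 1)
            = (((q : ℝ) + 1) / Real.sqrt q) • (fun _ => (1 : ℝ)) := rfl
        rw [h2, map_smul, smul_eq_mul] at h1
        have h3 : (lam i - ((q : ℝ) + 1) / Real.sqrt q) * c i (fun _ => (1 : ℝ)) = 0 := by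
          linarith
        exact (mul_eq_zero.mp h3).resolve_left (sub_ne_zero.mpr hi)
      have hPf : ∀ f, c i (Pproj f) = c i f := by
        intro f
        rw [hP, map_sub, map_smul, hc1, smul_zero, sub_zero]
      have hcheb : ∀ n f, c i (chebOp q G n (Pproj f)) = Real.cos (n * θ) * c i f := by
        intro n f
        induction n using chebOp.induct with
        | case1 => simp [chebOp, hPf]
        | case2 =>
          have : chebOp q G 1 (Pproj f) = (1 / 2 : ℝ) • Tq q G (Pproj f) := rfl
          rw [this, map_smul, hcT, hPf, hcos, smul_eq_mul, Nat.cast_one, one_mul]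
          ring
        | case3 n ih1 ih2 =>
          have h1 : chebOp q G (n + 2) (Pproj f)
              = Tq q G (chebOp q G (n + 1) (Pproj f)) - chebOp q G n (Pproj f) := rfl
          rw [h1, map_sub, hcT, ih1, ih2, hcos]
          have h2 : Real.cos (((n + 2 : ℕ) : ℝ) * θ)
              = 2 * Real.cos θ * Real.cos (((n + 1 : ℕ) : ℝ) * θ) - Real.cos (n * θ) := by
            push_cast
            rw [show ((n : ℝ) + 2) * θ = (n + 1) * θ + θ by ring,
              show (n : ℝ) * θ = (n + 1) * θ - θ by ring, Real.cos_add, Real.cos_sub]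
            ring
          rw [h2]
          ring
      refine ⟨fun n => Real.cos (((2 * n : ℕ) : ℝ) * θ), fun n f => hcheb _ f,
        fun n => Real.abs_cos_le_one _, fun m n hmn => ?_⟩
      push_cast [Nat.cast_sub hmn]
      rw [show 2 * ((m : ℝ) + n) * θ = 2 * n * θ + 2 * m * θ by ring,
        show 2 * ((n : ℝ) - m) * θ = 2 * n * θ - 2 * m * θ by ring, Real.cos_add, Real.cos_sub]
      ring
  choose e he1 he2 he3 using hdich
  exact ⟨c, e, hpars, he1, he2, he3⟩

end Graph

lemma lpN_le_of_dual {V : Type*} [Fintype V] {p r : ℝ} (hpr : p.HolderConjugate r) (g : V → ℝ)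
    (D : ℝ) (hD : ∀ h : V → ℝ, ∑ x, |h x| ^ r ≤ 1 → ∑ x, h x * g x ≤ D) : lpN p g ≤ D := by
  obtain ⟨φ, hφ, hφe⟩ := (NNReal.isGreatest_Lp Finset.univ (fun x => ‖g x‖₊) hpr).1
  have h1 : lpN p g = ∑ x, |g x| * (φ x : ℝ) := by
    have := congrArg (fun a : NNReal => (a : ℝ)) hφe
    simp only [NNReal.coe_sum, NNReal.coe_mul, coe_nnnorm, NNReal.coe_rpow, Real.norm_eq_abs]
      at this
    rw [lpN, ← this]
  have h2 : ∑ x, (φ x : ℝ) ^ r ≤ 1 := by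
    have : ∑ x, φ x ^ r ≤ 1 := hφ
    exact_mod_cast this
  rw [h1]
  have h3 : ∑ x, |g x| * (φ x : ℝ) = ∑ x, (if 0 ≤ g x then (φ x : ℝ) else -φ x) * g x := by
    refine Finset.sum_congr rfl fun x _ => ?_
    split_ifs with hx
    · rw [abs_of_nonneg hx, mul_comm]
    · rw [abs_of_neg (not_le.mp hx)]
      ring
  rw [h3]
  refine hD _ (le_of_eq_of_le (Finset.sum_congr rfl fun x _ => ?_) h2)
  split_ifs <;> simp

lemma lpN_two {V : Type*} [Fintype V] (f : V → ℝ) : lpN 2 f = Real.sqrt (∑ x, f x ^ 2) := by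
  rw [lpN, Real.sqrt_eq_rpow]
  congr 1
  refine Finset.sum_congr rfl fun x _ => ?_
  rw [← sq_abs (f x)]
  exact_mod_cast Real.rpow_natCast |f x| 2

theorem statement3 (q : ℕ) (hq : 2 ≤ q) (β C₀ : ℝ) (hβ : 0 < β) (hC₀ : 0 < C₀)
    (p : ℝ) (hp : 2 < p) :
    ∃ C : ℝ, 0 < C ∧
      ∀ (V : Type) [Fintype V] [DecidableEq V] (G : SimpleGraph V) [DecidableRel G.Adj],
        G.IsRegularOfDegree (q + 1) → IsRamanujan q G →
        ∀ N : ℕ, 2 ≤ N → Even N → (N : ℝ) ≤ Real.logb q (Fintype.card V) →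
          CondStarStar q G β C₀ N →
          ∀ (f : V → ℝ) (α : ℝ), α ∈ Set.Icc 0 Real.pi →
            lpN p (Wop q G N α f) ≤ C * Real.sqrt N * lpN 2 f := by
  set r : ℝ := p.conjExponent with hr
  have hpr : p.HolderConjugate r := Real.HolderConjugate.conjExponent (by linarith)
  have hr1 : 1 < r := hpr.symm.lt
  have hr2 : r < 2 := by
    rw [hr, Real.conjExponent, div_lt_iff₀ (by linarith)]
    linarith
  have hq2 : (2 : ℝ) ≤ q := by exact_mod_cast hq
  set B := max C₀ 1 with hB
  set ρ := max ((q : ℝ) ^ (-(2 * β))) (3 / 4) with hρ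
  have hρ4 : 3 / 4 ≤ ρ := le_max_right _ _
  have hρ0 : 0 < ρ := by linarith
  have hρ1 : ρ < 1 :=
    max_lt (Real.rpow_lt_one_of_one_lt_of_neg (by linarith) (by linarith)) (by norm_num)
  have hB1 : 1 ≤ B := le_max_right _ _
  set σ := ρ ^ ((2 - r) / 8) with hσ
  have hσ0 : 0 ≤ σ := (Real.rpow_pos_of_pos hρ0 _).le
  have hσ1 : σ < 1 := Real.rpow_lt_one hρ0.le hρ1 (by linarith)
  set E := 24 * ((5 * B + 3) * (2 / (1 - σ))) + 4 with hE
  have hE0 : 0 < E := by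
    have : 0 < 1 - σ := by linarith
    positivity
  refine ⟨Real.sqrt E, Real.sqrt_pos.mpr hE0, ?_⟩
  intro V _ _ G _ hG hR N hN2 hNe hNlog hK f α _
  obtain ⟨M, hM⟩ := hNe
  have hM2 : N / 2 = M := by omega
  have hcard : (q : ℝ) ^ N ≤ Fintype.card V := by
    have h0 : 0 < Fintype.card V := by
      by_contra h
      have h1 : Fintype.card V = 0 := by omega
      rw [h1, Nat.cast_zero, Real.logb_zero] at hNlog
      have : (2 : ℝ) ≤ N := by exact_mod_cast hN2
      linarith
    rw [Real.le_logb_iff_rpow_le (by linarith) (by exact_mod_cast h0), Real.rpow_natCast] at hNlog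
    exact hNlog
  obtain ⟨c, e, hc, hce, he, hmul⟩ := exists_spectral_coordinates hG hR
  have hc2 : ∀ g : V → ℝ, ∑ i, c i g ^ 2 = ∑ x, g x ^ 2 := by
    intro g
    simpa only [sq] using hc g g
  have hker : ∀ n ≤ M, ∀ h : V → ℝ,
      |∑ i, e i n * c i h ^ 2| ≤ 5 * B * ρ ^ n * (∑ x, |h x|) ^ 2 := by
    intro n hn h
    have h1 : ∑ i, e i n * c i h ^ 2 = ∑ x, h x * chebOp q G (2 * n) (Pproj h) x := by
      rw [← hc h]
      refine Finset.sum_congr rfl fun i _ => ?_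
      rw [hce]
      ring
    rw [h1]
    calc _ ≤ ∑ x, |h x * chebOp q G (2 * n) (Pproj h) x| := Finset.abs_sum_le_sum_abs _ _
      _ ≤ ∑ x, |h x| * (5 * B * ρ ^ n * ∑ y, |h y|) := by
          refine Finset.sum_le_sum fun x _ => ?_
          rw [abs_mul]
          exact mul_le_mul_of_nonneg_left (abs_chebOp_Pproj_le hq hG hcard hK hB1
            (le_max_left _ _) (le_max_left _ _) hρ4 h n (by omega) x) (abs_nonneg _)
      _ = _ := by rw [← Finset.sum_mul]; ring
  refine lpN_le_of_dual hpr _ _ fun h hh => ?_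
  have hw : ∑ i, c i h ^ 2 ≤ 1 := by
    rw [hc2]
    exact sum_sq_le_one (by linarith) hr2.le hh
  have hmb := multiplier_bound (fun i => c i h) hw e he hmul (5 * B + 3) σ (by linarith) hσ0 hσ1 M
    (by omega) (fun n hn => interpolation_bound c hc2 (fun i => e i n) (fun i => he i n) (5 * B) ρ
      (by linarith) hρ0 hρ1 n (hker n hn) r hr1 hr2 h hh)
    (fun n => Real.cos (2 * n * α)) (fun n => Real.abs_cos_le_one _)
  have hMN : (2 : ℝ) * M = N := by
    rw [hM]
    push_cast
    ring
  rw [← hE, hMN] at hmb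
  have hW : ∀ i, c i (Wop q G N α f)
      = (∑ n ∈ Finset.Icc 1 M, Real.cos (2 * n * α) * e i n) * c i f := by
    intro i
    have h1 : Wop q G N α f = ∑ n ∈ Finset.Icc 1 M,
        Real.cos (2 * n * α) • chebOp q G (2 * n) (Pproj f) := by
      funext x
      simp [Wop, hM2, Finset.sum_apply]
    rw [h1, map_sum, Finset.sum_mul]
    refine Finset.sum_congr rfl fun n _ => ?_
    rw [map_smul, hce, smul_eq_mul]
    ring
  rw [← hc h]
  calc ∑ i, c i h * c i (Wop q G N α f)
      = ∑ i, ((∑ n ∈ Finset.Icc 1 M, Real.cos (2 * n * α) * e i n) * c i h) * c i f := by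
        refine Finset.sum_congr rfl fun i _ => ?_
        rw [hW]
        ring
    _ ≤ Real.sqrt (∑ i, ((∑ n ∈ Finset.Icc 1 M, Real.cos (2 * n * α) * e i n) * c i h) ^ 2)
          * Real.sqrt (∑ i, c i f ^ 2) := Real.sum_mul_le_sqrt_mul_sqrt _ _ _
    _ ≤ Real.sqrt (E * N) * lpN 2 f := by
        rw [lpN_two, hc2]
        simp only [mul_pow]
        gcongr
    _ = _ := by rw [Real.sqrt_mul hE0.le]
end
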